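/- Fix an integer d ≥ 3, a finite set M and μ ∈ I_d(M). Then the upper sofic entropy satisfies h̄(μ) ≥ 0 if and only if μ is weakly typical, and the lower sofic entropy satisfies h̲(μ) ≥ 0 if and only if μ is strongly typical. -/

import Mathlib

open MeasureTheory Filter Topology
open scoped ENNReal Classical

noncomputable section

namespace TreeEntropy

@[ext]
structure RCG (M : Type*) where
  col : List ℕ → Option M
  adj : List ℕ × List ℕ → Bool

variable {M : Type*}

def resS (r : ℕ) (g : RCG M) : RCG M where
  col l := if l.length ≤ r then g.col l else none
  adj p := if p.1.length ≤ r ∧ p.2.length ≤ r then g.adj p else false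

def rcgDist (g g' : RCG M) : ℝ :=
  ∑' r : ℕ, if resS r g = resS r g' then 0 else (2:ℝ)⁻¹ ^ r

private lemma rcg_summable (a b : RCG M) : Summable
    (fun r : ℕ => if resS r a = resS r b then (0:ℝ) else (2:ℝ)⁻¹ ^ r) := by
  refine Summable.of_nonneg_of_le (fun r => ?_) (fun r => ?_)
    (summable_geometric_of_lt_one (by norm_num) (by norm_num : (2:ℝ)⁻¹ < 1))
  · split
    · exact le_rfl
    · positivity
  · split
    · positivity
    · exact le_rfl

private lemma rcg_nonneg (a b : RCG M) (r : ℕ) :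
    (0:ℝ) ≤ if resS r a = resS r b then (0:ℝ) else (2:ℝ)⁻¹ ^ r := by
  split
  · exact le_rfl
  · positivity

private lemma rcgDist_self (g : RCG M) : rcgDist g g = 0 := by simp [rcgDist]

private lemma rcgDist_comm (g g' : RCG M) : rcgDist g g' = rcgDist g' g :=
  tsum_congr fun r => if_congr eq_comm rfl rfl

private lemma rcgDist_triangle (g₁ g₂ g₃ : RCG M) :
    rcgDist g₁ g₃ ≤ rcgDist g₁ g₂ + rcgDist g₂ g₃ := by
  unfold rcgDist
  rw [← Summable.tsum_add (rcg_summable _ _) (rcg_summable _ _)]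
  refine Summable.tsum_le_tsum (fun r => ?_) (rcg_summable _ _)
    ((rcg_summable _ _).add (rcg_summable _ _))
  have hx : (0:ℝ) ≤ (2:ℝ)⁻¹ ^ r := by positivity
  by_cases h12 : resS r g₁ = resS r g₂
  · by_cases h23 : resS r g₂ = resS r g₃
    · rw [if_pos h12, if_pos h23, if_pos (h12.trans h23)]; linarith
    · rw [if_pos h12, if_neg h23, zero_add]
      split_ifs <;> linarith
  · by_cases h23 : resS r g₂ = resS r g₃
    · rw [if_neg h12, if_pos h23, add_zero]
      split_ifs <;> linarith
    · rw [if_neg h12, if_neg h23]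
      split_ifs <;> linarith

private lemma rcgDist_eq_zero (g g' : RCG M) (h : rcgDist g g' = 0) : g = g' := by
  unfold rcgDist at h
  have hr : ∀ r : ℕ, resS r g = resS r g' := by
    intro r
    by_contra hne
    have hpos : (0:ℝ) <
        ∑' r : ℕ, if resS r g = resS r g' then (0:ℝ) else (2:ℝ)⁻¹ ^ r :=
      Summable.tsum_pos (rcg_summable g g') (rcg_nonneg g g') r
        (by rw [if_neg hne]; positivity)
    exact absurd h hpos.ne'
  have hc : g.col = g'.col := by
    funext l
    have h1 := congrFun (congrArg RCG.col (hr l.length)) l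
    simpa [resS] using h1
  have ha : g.adj = g'.adj := by
    funext p
    have h1 := congrFun (congrArg RCG.adj (hr (max p.1.length p.2.length))) p
    simpa [resS, le_max_left, le_max_right] using h1
  exact RCG.ext hc ha

instance : MetricSpace (RCG M) where
  dist := rcgDist
  dist_self := rcgDist_self
  dist_comm := rcgDist_comm
  dist_triangle := rcgDist_triangle
  eq_of_dist_eq_zero := rcgDist_eq_zero _ _

instance : MeasurableSpace (RCG M) := borel _
instance : BorelSpace (RCG M) := ⟨rfl⟩


/-! ### The `d`-regular tree `T_d` -/

/-- A list `l = [i_k, …, i_1]` (deepest step first) is the breadth-first-search label of a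
vertex of the `d`-regular tree `T_d` iff its first (root-side) step lies in `{1, …, d}` and all
subsequent steps lie in `{1, …, d-1}`. -/
def ValidTd (d : ℕ) (l : List ℕ) : Prop :=
  (∀ i ∈ l.dropLast, 1 ≤ i ∧ i ≤ d - 1) ∧ (∀ i ∈ l.getLast?, 1 ≤ i ∧ i ≤ d)

/-- The vertex set of the `d`-regular tree `T_d`. -/
def TdVertex (d : ℕ) : Type := {l : List ℕ // ValidTd d l}

/-- The root `o` of `T_d`. -/
def rootTd (d : ℕ) : TdVertex d := ⟨[], by constructor <;> simp [List.getLast?]⟩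

/-- The first neighbor `1` of the root of `T_d` (defined as the root for the degenerate case
`d = 0`, which never occurs below). -/
def node1 (d : ℕ) : TdVertex d :=
  if h : 1 ≤ d then ⟨[1], by constructor <;> simp [List.getLast?, h]⟩ else rootTd d

/-- The graph structure of the `d`-regular tree: two vertices are adjacent iff one is obtained
from the other by adding one step. -/
def TdGraph (d : ℕ) : SimpleGraph (TdVertex d) where
  Adj v w := (∃ i, w.1 = i :: v.1) ∨ (∃ i, v.1 = i :: w.1)
  symm := ⟨by intro v w h; tauto⟩
  loopless := ⟨by
    rintro v (⟨i, h⟩ | ⟨i, h⟩) <;>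
      · have := congrArg List.length h
        simp at this⟩

/-- Graph distance between two vertices of a tree encoded by their BFS labels: the nearest
common ancestor corresponds to the longest common suffix. -/
def treeDist (u w : List ℕ) : ℕ :=
  ((u.reverse.zip w.reverse).takeWhile (fun p => p.1 = p.2)).length |> fun c =>
    (u.length - c) + (w.length - c)

/-- The ball `S_r = B_r(o)` of radius `r` around the root of `T_d`. -/
def SrSet (d r : ℕ) : Set (TdVertex d) := {v | v.1.length ≤ r}

/-- The set `E_r = B_{r-1}({o,1})` of vertices at distance at most `r-1` from the edge `{o,1}`
of `T_d` (for `r ≥ 1`). -/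
def ErSet (d r : ℕ) : Set (TdVertex d) :=
  {v | v.1.length + 1 ≤ r ∨ (v.1.getLast? = some 1 ∧ v.1.length ≤ r)}

lemma ErSet_subset_SrSet (d r : ℕ) : ErSet d r ⊆ SrSet d r := by
  rintro v (h | ⟨-, h⟩) <;> simp only [SrSet, Set.mem_setOf_eq] <;> omega

/-! ### Invariant processes on `T_d` and their entropies -/

variable (d : ℕ) (M : Type*)

/-- `I_d(M)`: the set of probability measures on `M^{T_d}` invariant under all automorphisms
of the tree `T_d`. -/
def InvMeas [MeasurableSpace M] : Set (Measure (TdVertex d → M)) :=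
  {μ | IsProbabilityMeasure μ ∧
    ∀ φ : TdGraph d ≃g TdGraph d, μ.map (fun x => fun v => x (φ v)) = μ}

variable {d M}

/-- The Shannon entropy of (the distribution of) a random variable with law `μ`, a measure
with countable support on a discrete space. -/
def shannon {α : Type*} [MeasurableSpace α] (μ : Measure α) : ℝ :=
  ∑' a : α, Real.negMulLog (μ {a}).toReal

/-- The restriction `X_S` of a process `X` on `T_d` to a subset `S` of the vertices:
the pushforward of its law. -/
def restrictTo [MeasurableSpace M] (S : Set (TdVertex d))
    (μ : Measure (TdVertex d → M)) : Measure (↥S → M) :=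
  μ.map (fun x => fun v => x v.1)

/-- The annealed entropy `Σ_r(μ) = H(X_{S_r}) - (d/2) H(X_{E_r})`. -/
def SigmaR [MeasurableSpace M] (d : ℕ) (r : ℕ) (μ : Measure (TdVertex d → M)) : ℝ :=
  shannon (restrictTo (SrSet d r) μ) - (d / 2 : ℝ) * shannon (restrictTo (ErSet d r) μ)

/-- The annealed entropy `Σ(μ) = lim_r Σ_r(μ)`: the limit of the non-increasing sequence
`r ↦ Σ_r(μ)` (`r ≥ 1`), as an extended real (the limit may be `-∞`). -/
def SigmaInf [MeasurableSpace M] (d : ℕ) (μ : Measure (TdVertex d → M)) : EReal :=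
  ⨅ r : ℕ, ((SigmaR d (r + 1) μ : ℝ) : EReal)

/-- `Σ_e(X) = (d/2) H(X_{E_1}) - (d-1) H(X_o)`. -/
def SigmaE [MeasurableSpace M] (d : ℕ) (μ : Measure (TdVertex d → M)) : ℝ :=
  (d / 2 : ℝ) * shannon (restrictTo (ErSet d 1) μ)
    - ((d : ℝ) - 1) * shannon (restrictTo ({rootTd d} : Set (TdVertex d)) μ)

/-! ### Markov processes on `T_d` -/

/-- The elementary cylinder event: the coloring takes the values prescribed by `y` on `S`. -/
def cylEvent (S : Set (TdVertex d)) (y : TdVertex d → M) : Set (TdVertex d → M) :=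
  {x | ∀ v ∈ S, x v = y v}

/-- The side of the edge `{u,w}` containing `u`, in the tree `T_d`. -/
def sideOf (u w : TdVertex d) : Set (TdVertex d) :=
  {v | treeDist v.1 u.1 < treeDist v.1 w.1}

/-- `B_{r-1}({u,w})`: the set of vertices at distance at most `r-1` from the edge `{u,w}`. -/
def edgeBall (r : ℕ) (u w : TdVertex d) : Set (TdVertex d) :=
  {v | treeDist v.1 u.1 + 1 ≤ r ∨ treeDist v.1 w.1 + 1 ≤ r}

/-- A probability measure on `M^{T_d}` is `r`-Markov on a subset `A` of `T_d` if, for every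
edge `{u,w}` of `A`, conditioned on the value on the `(r-1)`-neighborhood of the edge
(within `A`), the processes on the two sides of the edge (within `A`) are independent;
equivalently, the corresponding products of cylinder probabilities agree.  For `A` the whole
tree and `r = 1` this is the edge-Markov property. -/
def rMarkovOn [MeasurableSpace M] (r : ℕ) (A : Set (TdVertex d))
    (μ : Measure (TdVertex d → M)) : Prop :=
  ∀ u w : TdVertex d, u ∈ A → w ∈ A → (TdGraph d).Adj u w →
    ∀ F₁ F₂ : Finset (TdVertex d), ↑F₁ ⊆ sideOf u w ∩ A → ↑F₂ ⊆ sideOf w u ∩ A →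
      ∀ y : TdVertex d → M,
        μ (cylEvent (↑F₁ ∪ ↑F₂ ∪ (edgeBall r u w ∩ A)) y)
            * μ (cylEvent (edgeBall r u w ∩ A) y)
          = μ (cylEvent (↑F₁ ∪ (edgeBall r u w ∩ A)) y)
            * μ (cylEvent (↑F₂ ∪ (edgeBall r u w ∩ A)) y)

/-- A probability measure on `M^{T_d}` is `r`-Markov if, conditioned on the value on the
`(r-1)`-neighborhood of any edge, the processes on the two sides of the edge are
independent. -/
def rMarkov [MeasurableSpace M] (r : ℕ) (μ : Measure (TdVertex d → M)) : Prop :=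
  rMarkovOn r Set.univ μ

/-- A probability measure on `M^{T_d}` is vertex-Markov if, conditioned on the value at a
vertex, the processes on the pending subtrees of that vertex are independent. -/
def vertexMarkov [MeasurableSpace M] (μ : Measure (TdVertex d → M)) : Prop :=
  ∀ v : TdVertex d, ∀ k : ℕ, ∀ u : Fin k → TdVertex d,
    Function.Injective u → (∀ i, (TdGraph d).Adj v (u i)) →
    ∀ F : Fin k → Finset (TdVertex d), (∀ i, ↑(F i) ⊆ sideOf (u i) v) →
      ∀ y : TdVertex d → M,
        μ (cylEvent ((⋃ i, ↑(F i)) ∪ {v}) y) * (μ (cylEvent {v} y)) ^ (k - 1)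
          = ∏ i : Fin k, μ (cylEvent (↑(F i) ∪ {v}) y)

/-- `X_{S_1}` is a vertex-Markov process on `S_1`: the values at the `d` neighbors of the
root are conditionally independent given the value at the root. -/
def vertexMarkovOnS1 [MeasurableSpace M] (d : ℕ) (μ : Measure (TdVertex d → M)) : Prop :=
  ∀ y : TdVertex d → M,
    μ (cylEvent (SrSet d 1) y) * (μ (cylEvent ({rootTd d} : Set (TdVertex d)) y)) ^ (d - 1)
      = ∏ i ∈ Finset.Icc 1 d,
          μ (cylEvent {v : TdVertex d | v = rootTd d ∨ v.1 = [i]} y)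


/-! ### The randomly labeled rooted colored graph associated to a finite colored graph

Given a finite colored graph `(G,f)` and a vertex `v`, the associated randomly labeled rooted
colored graph is obtained by a breadth-first search exploration of the connected component of
`v` started at `v`, ties between vertices being broken uniformly at random.  We implement the
uniformly random tie-breaking by a uniformly random priority permutation `σ`. -/

variable {M : Type*} {n : ℕ}

/-- The `k`-th layer of the breadth-first search of `G` started at `v`, ordered according to
the position of the parents in the previous layer, ties being broken by the priority `σ`. -/
def bfsLayer (G : SimpleGraph (Fin n)) (v : Fin n) (σ : Equiv.Perm (Fin n)) :
    ℕ → List (Fin n)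
  | 0 => [v]
  | (k + 1) =>
    let prev := bfsLayer G v σ k
    let key : Fin n → ℕ := fun w =>
      (prev.idxOf (((prev.find? (fun u => decide (G.Adj u w))).getD v))) * n + (σ w : ℕ)
    ((List.finRange n).filter
        (fun w => decide (G.Reachable v w ∧ G.dist v w = k + 1))).mergeSort
      (fun a b => key a ≤ key b)

/-- The breadth-first-search label of the vertex `w` lying in layer `k` of the exploration of
`G` started at `v` with tie-breaking priority `σ`. -/
def bfsPathAux (G : SimpleGraph (Fin n)) (v : Fin n) (σ : Equiv.Perm (Fin n)) :
    ℕ → Fin n → Option (List ℕ)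
  | 0, w => if w = v then some [] else none
  | (k + 1), w =>
    match (bfsLayer G v σ k).find? (fun u => decide (G.Adj u w)) with
    | none => none
    | some p =>
      let L := bfsLayer G v σ (k + 1)
      let j := 1 + ((L.takeWhile (fun w' => w' ≠ w)).filter
        (fun w' => (bfsLayer G v σ k).find? (fun u => decide (G.Adj u w')) = some p)).length
      (bfsPathAux G v σ k p).map (fun pl => j :: pl)

/-- The breadth-first-search label of the vertex `w` in the exploration of the connected
component of `v` in `G`, with tie-breaking priority `σ` (`none` if `w` is not in the component
of `v`). -/
def bfsPath (G : SimpleGraph (Fin n)) (v : Fin n) (σ : Equiv.Perm (Fin n)) (w : Fin n) :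
    Option (List ℕ) :=
  if G.Reachable v w then bfsPathAux G v σ (G.dist v w) w else none

/-- The rooted colored graph obtained from the colored graph `(G,f)` by the breadth-first
search exploration of the connected component of `v` rooted at `v`, with tie-breaking
priority `σ`. -/
def bfsRCG (G : SimpleGraph (Fin n)) (f : Fin n → M) (v : Fin n) (σ : Equiv.Perm (Fin n)) :
    RCG M where
  col l := if h : ∃ w, bfsPath G v σ w = some l then some (f h.choose) else none
  adj p :=
    if (∃ w₁ w₂, bfsPath G v σ w₁ = some p.1 ∧ bfsPath G v σ w₂ = some p.2 ∧ G.Adj w₁ w₂)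
    then true else false

/-- `distr_{G,v}(f)`: the law of the randomly labeled rooted colored graph obtained from the
connected component of `v` in the colored graph `(G,f)`, rooted at `v`. -/
def distrAt (G : SimpleGraph (Fin n)) (f : Fin n → M) (v : Fin n) : Measure (RCG M) :=
  ((Nat.factorial n : ℝ≥0∞))⁻¹ •
    ∑ σ : Equiv.Perm (Fin n), Measure.dirac (bfsRCG G f v σ)

/-- `distr_G(f) = (1/|V|) ∑_{v ∈ V} distr_{G,v}(f)`. -/
def distrG (G : SimpleGraph (Fin n)) (f : Fin n → M) : Measure (RCG M) :=
  ((n : ℝ≥0∞))⁻¹ • ∑ v : Fin n, distrAt G f v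

/-! ### Random regular graphs -/

/-- The set `𝓖_n(d)` of simple `d`-regular graphs on the vertex set `{1, …, n}`. -/
def regularGraphs (d n : ℕ) : Set (SimpleGraph (Fin n)) :=
  {G | ∀ v, (G.neighborSet v).ncard = d}

/-- The probability that a uniformly distributed random `d`-regular graph `G_n` on `n`
vertices belongs to `A`. -/
def PrG (d n : ℕ) (A : Set (SimpleGraph (Fin n))) : ℝ :=
  ((regularGraphs d n ∩ A).ncard : ℝ) / ((regularGraphs d n).ncard : ℝ)

/-- The expectation of `F(G_n)` for a uniformly distributed random `d`-regular graph `G_n`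
on `n` vertices. -/
def ExG (d n : ℕ) (F : SimpleGraph (Fin n) → ℝ) : ℝ :=
  (∑ᶠ G ∈ regularGraphs d n, F G) / ((regularGraphs d n).ncard : ℝ)

/-- The integers `n` for which the set of simple `d`-regular graphs on `n` vertices is
non-empty: `n ≥ d + 1` and `nd` even.  Limits `n → ∞` are taken along this set. -/
def goodN (d : ℕ) : Set ℕ := {n | d + 1 ≤ n ∧ Even (n * d)}

/-- The filter `n → ∞` along `{n : n ≥ d+1, nd even}`. -/
def goodFilter (d : ℕ) : Filter ℕ := Filter.atTop ⊓ Filter.principal (goodN d)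

/-! ### The embedding of invariant processes into rooted colored graphs -/

/-- The rooted colored graph `(T_d, x, o)` associated to a coloring `x` of `T_d` (the
canonical labeling of `T_d` is a breadth-first-search labeling; for an invariant process the
resulting law is that of the randomly labeled rooted colored graph). -/
def iotaTd (d : ℕ) (x : TdVertex d → M) : RCG M where
  col l := if h : ValidTd d l then some (x ⟨l, h⟩) else none
  adj p :=
    if (ValidTd d p.1 ∧ ValidTd d p.2 ∧ ((∃ i, p.2 = i :: p.1) ∨ (∃ i, p.1 = i :: p.2)))
    then true else false

/-- The law, as a probability measure on rooted colored graphs, of the randomly labeled rooted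
colored tree `(T_d, X, o)` where `X` has law `μ`. -/
def lawTd (d : ℕ) [MeasurableSpace M] (μ : Measure (TdVertex d → M)) : Measure (RCG M) :=
  μ.map (iotaTd d)

/-! ### Micro-state (sofic) entropy -/

/-- `𝓕_G(μ,r,ε)`: the set of colorings `f` of `G` whose radius-`r` local statistics are
`ε`-close (in the Lévy-Prokhorov distance, which generates the weak topology) to the
radius-`r` restriction of `μ`. -/
def FSet (d : ℕ) [MeasurableSpace M] (μ : Measure (TdVertex d → M)) (r : ℕ) (ε : ℝ)
    (G : SimpleGraph (Fin n)) : Set (Fin n → M) :=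
  {f | levyProkhorovDist ((distrG G f).map (resS r)) ((lawTd d μ).map (resS r)) ≤ ε}

/-- `H_{G}(μ,r,ε) = (1/n) log |𝓕_G(μ,r,ε)| ∈ {-∞} ∪ [0,∞)`. -/
def HG (d : ℕ) [MeasurableSpace M] (μ : Measure (TdVertex d → M)) (r : ℕ) (ε : ℝ)
    (G : SimpleGraph (Fin n)) : EReal :=
  if FSet d μ r ε G = ∅ then ⊥
  else ((Real.log ((FSet d μ r ε G).ncard) / n : ℝ) : EReal)

/-- `h_n(μ,r,ε,α)`: the `α`-quantile
`sup { h ∈ {-∞} ∪ [0,∞) : ℙ(H_{G_n}(μ,r,ε) ≥ h) ≥ α }`. -/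
def hquant (d : ℕ) [MeasurableSpace M] (μ : Measure (TdVertex d → M)) (r : ℕ) (ε : ℝ)
    (α : ℝ) (n : ℕ) : EReal :=
  sSup {h : EReal | (h = ⊥ ∨ 0 ≤ h) ∧
    α ≤ PrG d n {G : SimpleGraph (Fin n) | h ≤ HG d μ r ε G}}

/-- The upper entropy `h̄(μ,r,α) = lim_{ε → 0} limsup_n h_n(μ,r,ε,α)` (the limit over `ε`
of a quantity non-decreasing in `ε`, i.e. the infimum over `ε > 0`). -/
def hbarA (d : ℕ) [MeasurableSpace M] (μ : Measure (TdVertex d → M)) (r : ℕ) (α : ℝ) :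
    EReal :=
  ⨅ ε : {e : ℝ // 0 < e}, (goodFilter d).limsup (fun n => hquant d μ r ε.1 α n)

/-- The lower entropy `h̲(μ,r,α) = lim_{ε → 0} liminf_n h_n(μ,r,ε,α)`. -/
def hlowA (d : ℕ) [MeasurableSpace M] (μ : Measure (TdVertex d → M)) (r : ℕ) (α : ℝ) :
    EReal :=
  ⨅ ε : {e : ℝ // 0 < e}, (goodFilter d).liminf (fun n => hquant d μ r ε.1 α n)

/-- `h̄(μ,r)`: the common value of `h̄(μ,r,α)`, `0 < α < 1`. -/
def hbarR (d : ℕ) [MeasurableSpace M] (μ : Measure (TdVertex d → M)) (r : ℕ) : EReal :=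
  hbarA d μ r (1 / 2)

/-- `h̲(μ,r)`: the common value of `h̲(μ,r,α)`, `0 < α < 1`. -/
def hlowR (d : ℕ) [MeasurableSpace M] (μ : Measure (TdVertex d → M)) (r : ℕ) : EReal :=
  hlowA d μ r (1 / 2)

/-- The upper sofic entropy `h̄(μ) = lim_{r → ∞} h̄(μ,r)` (the limit of a non-increasing
sequence, i.e. the infimum over `r`). -/
def hbar (d : ℕ) [MeasurableSpace M] (μ : Measure (TdVertex d → M)) : EReal :=
  ⨅ r : ℕ, hbarR d μ r

/-- The lower sofic entropy `h̲(μ) = lim_{r → ∞} h̲(μ,r)`. -/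
def hlow (d : ℕ) [MeasurableSpace M] (μ : Measure (TdVertex d → M)) : EReal :=
  ⨅ r : ℕ, hlowR d μ r

/-! ### Typical processes -/

/-- The probability that the random `d`-regular graph `G_n` admits a coloring whose local
statistics are `ε`-close to `μ`. -/
def typicalPr (d : ℕ) [MeasurableSpace M] (μ : Measure (TdVertex d → M)) (ε : ℝ) (n : ℕ) :
    ℝ :=
  PrG d n {G : SimpleGraph (Fin n) |
    ∃ f : Fin n → M, levyProkhorovDist (distrG G f) (lawTd d μ) ≤ ε}

/-- `μ ∈ I_d(M)` is weakly typical if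
`lim_{ε → 0} limsup_{n → ∞} ℙ(∃ f : d(distr_{G_n}(f), μ) ≤ ε) = 1`. -/
def WeaklyTypical (d : ℕ) [MeasurableSpace M] (μ : Measure (TdVertex d → M)) : Prop :=
  Tendsto (fun ε => (goodFilter d).limsup (fun n => typicalPr d μ ε n))
    (nhdsWithin 0 (Set.Ioi 0)) (nhds 1)

/-- `μ ∈ I_d(M)` is strongly typical if
`lim_{ε → 0} lim_{n → ∞} ℙ(∃ f : d(distr_{G_n}(f), μ) ≤ ε) = 1` (in particular the inner
limits along `n → ∞` exist). -/
def StronglyTypical (d : ℕ) [MeasurableSpace M] (μ : Measure (TdVertex d → M)) : Prop :=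
  ∃ L : ℝ → ℝ,
    (∀ ε : ℝ, 0 < ε → Tendsto (fun n => typicalPr d μ ε n) (goodFilter d) (nhds (L ε))) ∧
    Tendsto L (nhdsWithin 0 (Set.Ioi 0)) (nhds 1)


/-! ### Processes on balls of `T_d` and the sets `I_{d,r}(M)`, `I_e(M)` -/

/-- The ball `S_r` of `T_d` as an induced subgraph. -/
def SrGraph (d r : ℕ) : SimpleGraph ↥(SrSet d r) := (TdGraph d).induce (SrSet d r)

/-- The set `E_r` of `T_d` as an induced subgraph. -/
def ErGraph (d r : ℕ) : SimpleGraph ↥(ErSet d r) := (TdGraph d).induce (ErSet d r)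

lemma root_mem_Er (d r : ℕ) (hr : 1 ≤ r) : rootTd d ∈ ErSet d r := by
  left; simpa [rootTd] using hr

lemma node1_mem_Er (d r : ℕ) (hr : 1 ≤ r) : node1 d ∈ ErSet d r := by
  by_cases h : 1 ≤ d
  · right
    constructor <;> simp [node1, h, List.getLast?, hr]
  · simpa [node1, h] using root_mem_Er d r hr

variable {M : Type*}

/-- The restriction to `E_r ⊆ S_r` of a probability measure on `M^{S_r}`. -/
def restrictErOfSr [MeasurableSpace M] (d r : ℕ) (p : Measure (↥(SrSet d r) → M)) :
    Measure (↥(ErSet d r) → M) :=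
  p.map (fun x => fun v : ↥(ErSet d r) => x ⟨v.1, ErSet_subset_SrSet d r v.2⟩)

/-- `I_{d,r}(M)`: the set of probability measures on `M^{S_r}` which are invariant under the
automorphisms of `S_r` and whose restriction to `E_r` is invariant under switching the two
sides of the edge `{o,1}`. -/
def IdrMeas (d r : ℕ) (M : Type*) [MeasurableSpace M] :
    Set (Measure (↥(SrSet d r) → M)) :=
  {p | IsProbabilityMeasure p ∧
    (∀ φ : SrGraph d r ≃g SrGraph d r, p.map (fun x => fun v => x (φ v)) = p) ∧
    (∀ ψ : ErGraph d r ≃g ErGraph d r,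
      (∀ hv : rootTd d ∈ ErSet d r, ((ψ ⟨rootTd d, hv⟩ : ↥(ErSet d r)) : TdVertex d) = node1 d) →
      (restrictErOfSr d r p).map (fun x => fun v => x (ψ v)) = restrictErOfSr d r p)}

/-- The annealed entropy `Σ(p) = H(X_{S_r}) - (d/2) H(X_{E_r})` of `p ∈ I_{d,r}(M)`. -/
def SigmaP [MeasurableSpace M] (d r : ℕ) (p : Measure (↥(SrSet d r) → M)) : ℝ :=
  shannon p - (d / 2 : ℝ) * shannon (restrictErOfSr d r p)

/-- The involution of `E_1 = {o, 1}` switching the two sides of the edge `{o,1}`. -/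
def swapE1 (d : ℕ) : ↥(ErSet d 1) → ↥(ErSet d 1) := fun v =>
  if (v : TdVertex d) = rootTd d then ⟨node1 d, node1_mem_Er d 1 le_rfl⟩
  else ⟨rootTd d, root_mem_Er d 1 le_rfl⟩

/-- `I_e(M)`: the set of probability measures on `M^{E_1}` invariant under switching the two
sides of the edge `{o,1}`. -/
def IeMeas (d : ℕ) (M : Type*) [MeasurableSpace M] : Set (Measure (↥(ErSet d 1) → M)) :=
  {p | IsProbabilityMeasure p ∧ p.map (fun x => fun v => x (swapE1 d v)) = p}

/-- The annealed entropy `Σ(p) = (d/2) H(X_{E_1}) - (d-1) H(X_o)` of `p ∈ I_e(M)`. -/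
def SigmaPe [MeasurableSpace M] (d : ℕ) (p : Measure (↥(ErSet d 1) → M)) : ℝ :=
  (d / 2 : ℝ) * shannon p
    - ((d : ℝ) - 1) * shannon (p.map (fun x => x ⟨rootTd d, root_mem_Er d 1 le_rfl⟩))

/-! ### Factor graphs: functions of rooted unlabeled colored graphs of radius `r` -/

/-- The vertex set of a rooted colored graph. -/
def vertsOf (g : RCG M) : Set (List ℕ) := {l | g.col l ≠ none}

/-- An isomorphism of rooted colored graphs (a color- and adjacency-preserving bijection of
the vertex sets mapping root to root). -/
def RCGRootedIso (g g' : RCG M) : Prop :=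
  ∃ e : ↥(vertsOf g) ≃ ↥(vertsOf g'),
    (∀ v, g'.col ((e v) : List ℕ) = g.col (v : List ℕ)) ∧
    (∀ v w, g'.adj (((e v) : List ℕ), ((e w) : List ℕ)) = g.adj ((v : List ℕ), (w : List ℕ))) ∧
    (∀ h : [] ∈ vertsOf g, ∀ _ : [] ∈ vertsOf g', ((e ⟨[], h⟩) : List ℕ) = [])

/-- A function on rooted unlabeled colored graphs of radius `r`: a function of rooted colored
graphs which only depends on the isomorphism class of the ball of radius `r` around the
root. -/
def IsRadiusRFn (r : ℕ) (ψ : RCG M → ℝ) : Prop :=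
  ∀ g g' : RCG M, RCGRootedIso (resS r g) (resS r g') → ψ g = ψ g'

/-- The value `ψ((G,f,v)_r)` of `ψ` at the rooted unlabeled colored graph given by the ball of
radius `r` around `v` in `(G,f)` (computed as the average over the random labelings, which is
the constant value of `ψ` on them when `ψ` is a function of the unlabeled graph). -/
def psiAt {n : ℕ} (G : SimpleGraph (Fin n)) (f : Fin n → M) (v : Fin n) (ψ : RCG M → ℝ) :
    ℝ :=
  ∫ g, ψ g ∂(distrAt G f v)

/-- The partition function `Z_G = ∑_f ∏_v exp(ψ((G,f,v)_r))` of the factor model `ψ`. -/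
def ZG {n : ℕ} [Fintype M] (G : SimpleGraph (Fin n)) (ψ : RCG M → ℝ) : ℝ :=
  ∑ f : Fin n → M, Real.exp (∑ v : Fin n, psiAt G f v ψ)

/-- The ground-state energy `L_G = max_f ∑_v ψ((G,f,v)_r)`. -/
def LG {n : ℕ} (G : SimpleGraph (Fin n)) (ψ : RCG M → ℝ) : ℝ :=
  sSup {x : ℝ | ∃ f : Fin n → M, x = ∑ v : Fin n, psiAt G f v ψ}

/-- The canonical rooted colored graph associated to a coloring of the ball `S_r` of `T_d`. -/
def iotaSr (d r : ℕ) (x : ↥(SrSet d r) → M) : RCG M where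
  col l := if h : ValidTd d l ∧ l.length ≤ r then some (x ⟨⟨l, h.1⟩, h.2⟩) else none
  adj p := if (ValidTd d p.1 ∧ ValidTd d p.2 ∧ p.1.length ≤ r ∧ p.2.length ≤ r ∧
      ((∃ i, p.2 = i :: p.1) ∨ (∃ i, p.1 = i :: p.2))) then true else false

/-- `⟨p, ψ⟩ = E[ψ(X)]` where `X` has law `p ∈ I_{d,r}(M)`. -/
def pairing [MeasurableSpace M] (d r : ℕ) (p : Measure (↥(SrSet d r) → M))
    (ψ : RCG M → ℝ) : ℝ :=
  ∫ x, ψ (iotaSr d r x) ∂p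

/-! ### Annealed quantities for random regular graphs -/

/-- `log` with the convention `log 0 = -∞`, with values in the extended reals. -/
def elog (x : ℝ) : EReal := if x ≤ 0 then ⊥ else ((Real.log x : ℝ) : EReal)

/-- The set `𝓖_n(μ,r,ε)` of pairs `(G,f)` of a `d`-regular graph together with a coloring
whose radius-`r` local statistics are `ε`-close to `μ_r`. -/
def GnPairs (d : ℕ) [MeasurableSpace M] (μ : Measure (TdVertex d → M)) (r : ℕ) (ε : ℝ)
    (n : ℕ) : Set (SimpleGraph (Fin n) × (Fin n → M)) :=
  {Gf | Gf.1 ∈ regularGraphs d n ∧ Gf.2 ∈ FSet d μ r ε Gf.1}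

/-- The annealed entropy
`Σ_n(μ,r,ε) = (1/n) (log |𝓖_n(μ,r,ε)| - log |𝓖_n(d)|) = (1/n) log E |𝓕_{G_n}(μ,r,ε)|`. -/
def SigmaN (d : ℕ) [MeasurableSpace M] (μ : Measure (TdVertex d → M)) (r : ℕ) (ε : ℝ)
    (n : ℕ) : EReal :=
  (((n : ℝ)⁻¹ : ℝ) : EReal) *
    elog (((GnPairs d μ r ε n).ncard : ℝ) / ((regularGraphs d n).ncard : ℝ))

/-- The relaxed partition function `Z_G(β) = ∑_f exp(-nβ d(distr_G(f)_r, μ_r))`. -/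
def ZGbeta (d : ℕ) [MeasurableSpace M] {n : ℕ} [Fintype M] (μ : Measure (TdVertex d → M))
    (r : ℕ) (β : ℝ) (G : SimpleGraph (Fin n)) : ℝ :=
  ∑ f : Fin n → M, Real.exp (-(n : ℝ) * β *
    levyProkhorovDist ((distrG G f).map (resS r)) ((lawTd d μ).map (resS r)))


/-! ### Processes on unimodular Galton-Watson trees

A colored rooted tree `(T, X, o)` with `T` a subtree of the label set, rooted at `[]` and
with the children of a vertex `v` labeled `1 :: v, …, N_v :: v`, is encoded as a rooted
colored graph in `RCG M`. -/

/-- `g` is a canonically labeled colored rooted tree. -/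
def IsCanonTree (g : RCG M) : Prop :=
  g.col [] ≠ none ∧
  (∀ l : List ℕ, g.col l ≠ none → g.col l.tail ≠ none) ∧
  (∀ (v : List ℕ) (i : ℕ), 1 ≤ i → g.col ((i + 1) :: v) ≠ none → g.col (i :: v) ≠ none) ∧
  (∀ v : List ℕ, g.col (0 :: v) = none) ∧
  (∀ p : List ℕ × List ℕ, g.adj p = true ↔
    (g.col p.1 ≠ none ∧ g.col p.2 ≠ none ∧
      ((∃ i, p.2 = i :: p.1) ∨ (∃ i, p.1 = i :: p.2))))

/-- A finite canonically labeled tree. -/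
def IsFinTree (t : Finset (List ℕ)) : Prop :=
  [] ∈ t ∧ (∀ l ∈ t, l.tail ∈ t) ∧
  (∀ (v : List ℕ) (i : ℕ), 1 ≤ i → ((i + 1) :: v) ∈ t → (i :: v) ∈ t) ∧
  (∀ v : List ℕ, (0 :: v) ∉ t)

/-- The number of children of the vertex `v` in the finite tree `t`. -/
def childCountF (t : Finset (List ℕ)) (v : List ℕ) : ℕ :=
  (t.filter (fun w => w ≠ [] ∧ w.tail = v)).card

/-- The size-biased version `π̂(k) = (k+1) π(k+1) / d` of the offspring distribution `π`. -/
def sizeBiased (π : ℕ → ℝ) (dd : ℝ) (k : ℕ) : ℝ := (k + 1 : ℝ) * π (k + 1) / dd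

/-- The probability that the unimodular Galton-Watson tree with degree distribution `π`,
truncated at depth `k`, equals the finite tree `t`. -/
def treeWeight (π : ℕ → ℝ) (dd : ℝ) (k : ℕ) (t : Finset (List ℕ)) : ℝ :=
  π (childCountF t []) *
    ∏ v ∈ t.filter (fun v => v ≠ [] ∧ v.length < k), sizeBiased π dd (childCountF t v)

/-- The law of the underlying tree is the unimodular Galton-Watson law `UGW(π)`:
all finite-depth truncations have the prescribed distribution. -/
def IsUGWTreeLaw (π : ℕ → ℝ) (dd : ℝ) (μ : Measure (RCG M)) : Prop :=
  ∀ (k : ℕ) (t : Finset (List ℕ)), IsFinTree t → (∀ v ∈ t, v.length ≤ k) →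
    (μ {g | ∀ l : List ℕ, l.length ≤ k → (g.col l ≠ none ↔ l ∈ t)}).toReal
      = treeWeight π dd k t

/-- `e` realizes an isomorphism (not necessarily root-preserving) of the colored graphs `g`
and `g'`. -/
def IsIsoVia (g g' : RCG M) (e : List ℕ → List ℕ) : Prop :=
  Set.BijOn e (vertsOf g) (vertsOf g') ∧
  (∀ l ∈ vertsOf g, g'.col (e l) = g.col l) ∧
  (∀ l ∈ vertsOf g, ∀ l' ∈ vertsOf g, g'.adj (e l, e l') = g.adj (l, l'))

/-- A function on doubly rooted colored graphs, invariant under isomorphisms. -/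
def PairInvariant (F : RCG M → List ℕ → List ℕ → ℝ≥0∞) : Prop :=
  ∀ g g' e, IsIsoVia g g' e → ∀ u ∈ vertsOf g, ∀ v ∈ vertsOf g, F g' (e u) (e v) = F g u v

/-- Unimodularity (the mass-transport principle):
`E ∑_v F(G,o,v) = E ∑_v F(G,v,o)` for all isomorphism-invariant `F ≥ 0`. -/
def Unimodular (μ : Measure (RCG M)) : Prop :=
  ∀ F : RCG M → List ℕ → List ℕ → ℝ≥0∞, PairInvariant F →
    ∫⁻ g, (∑' v : ↥(vertsOf g), F g [] (v : List ℕ)) ∂μ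
      = ∫⁻ g, (∑' v : ↥(vertsOf g), F g (v : List ℕ) []) ∂μ

/-- `I_π(M)`: the laws of invariant (unimodular) processes `(T,X)` with colors in `M` over
the unimodular Galton-Watson tree with degree distribution `π` (of mean `dd`). -/
def IPiMeas (π : ℕ → ℝ) (dd : ℝ) (M : Type*) [MeasurableSpace M] :
    Set (Measure (RCG M)) :=
  {μ | IsProbabilityMeasure μ ∧ μ {g | IsCanonTree g} = 1 ∧ Unimodular μ ∧
    IsUGWTreeLaw π dd μ}

/-- The root degree `deg(o)` of a canonically labeled tree (the number of children of the
root). -/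
def rootDeg (g : RCG M) : ℕ := {i : ℕ | g.col [i] ≠ none}.ncard

/-- The edge-biased law `→μ(⬝) = (1/d) E[deg(o) 1{(T,X,(o,1)) ∈ ⬝}]` on colored edge-rooted
trees (the root edge being `([], [1])`). -/
def vecLaw (dd : ℝ) [MeasurableSpace M] (μ : Measure (RCG M)) : Measure (RCG M) :=
  (ENNReal.ofReal dd)⁻¹ • μ.withDensity (fun g => (rootDeg g : ℝ≥0∞))

/-- Membership in `E_r = B_{r-1}({o,1})` for a vertex of a canonically labeled tree. -/
def inErL (r : ℕ) (l : List ℕ) : Prop :=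
  l.length + 1 ≤ r ∨ (l.getLast? = some 1 ∧ l.length ≤ r)

/-- The restriction of a colored edge-rooted tree to `E_r = B_{r-1}({o,1})`. -/
def resE (r : ℕ) (g : RCG M) : RCG M where
  col l := if inErL r l then g.col l else none
  adj p := if inErL r p.1 ∧ inErL r p.2 then g.adj p else false

/-- The Shannon entropy `H(π)` of the probability mass function `π`. -/
def Hpmf (π : ℕ → ℝ) : ℝ := ∑' k : ℕ, Real.negMulLog (π k)

/-- The annealed entropy `Σ_r(μ) = H(X_{S_r}) - (d/2) H(→X_{E_r}) - H(π)` of an invariant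
process over the unimodular Galton-Watson tree. -/
def SigmaUGW (π : ℕ → ℝ) (dd : ℝ) [MeasurableSpace M] (r : ℕ) (μ : Measure (RCG M)) : ℝ :=
  shannon (μ.map (resS r)) - (dd / 2) * shannon ((vecLaw dd μ).map (resE r)) - Hpmf π

/-- `Σ(μ) = lim_{r → ∞} Σ_r(μ)` (the limit of a non-increasing sequence). -/
def SigmaUGWInf (π : ℕ → ℝ) (dd : ℝ) [MeasurableSpace M] (μ : Measure (RCG M)) : EReal :=
  ⨅ r : ℕ, ((SigmaUGW π dd (r + 1) μ : ℝ) : EReal)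

/-- `Σ_e(X) = (d/2) H(→X_{E_1}) - d H(→X_o) + H(X_o) - H(π)`. -/
def SigmaEUGW (π : ℕ → ℝ) (dd : ℝ) [MeasurableSpace M] (μ : Measure (RCG M)) : ℝ :=
  (dd / 2) * shannon ((vecLaw dd μ).map (resE 1))
    - dd * shannon ((vecLaw dd μ).map (resS 0))
    + shannon (μ.map (resS 0)) - Hpmf π

/-! ### Markov processes on random trees -/

/-- The side of the (potential) edge `{u,w}` containing `u`, among the labels. -/
def sideL (u w : List ℕ) : Set (List ℕ) := {v | treeDist v u < treeDist v w}

/-- `B_{r-1}({u,w})` among the labels. -/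
def edgeBallL (r : ℕ) (u w : List ℕ) : Set (List ℕ) :=
  {v | treeDist v u + 1 ≤ r ∨ treeDist v w + 1 ≤ r}

/-- The event that the tree structure agrees with that of `y` on `S` and that the colored
tree agrees with `y` on `B`. -/
def treeCylEvent (S B : Set (List ℕ)) (y : RCG M) : Set (RCG M) :=
  {g | (∀ l ∈ S, (g.col l ≠ none ↔ y.col l ≠ none)) ∧ (∀ l ∈ B, g.col l = y.col l)}

/-- A random colored tree is `r`-Markov on the ambient set `A` if, conditioned on the tree
and on the value on the `(r-1)`-neighborhood of an edge, the processes on the two sides of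
the edge are independent (conditioning on the tree is expressed through arbitrary finite
windows `S`). -/
def rMarkovTreeOn [MeasurableSpace M] (r : ℕ) (A : Set (List ℕ)) (μ : Measure (RCG M)) :
    Prop :=
  ∀ (u : List ℕ) (i : ℕ), 1 ≤ i → u ∈ A → (i :: u) ∈ A →
    ∀ F₁ F₂ : Finset (List ℕ), ↑F₁ ⊆ sideL u (i :: u) ∩ A → ↑F₂ ⊆ sideL (i :: u) u ∩ A →
    ∀ S : Finset (List ℕ), ↑S ⊆ A → ∀ y : RCG M,
      μ (treeCylEvent ↑S (edgeBallL r u (i :: u) ∩ A) y ∩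
          treeCylEvent ∅ ↑F₁ y ∩ treeCylEvent ∅ ↑F₂ y)
        * μ (treeCylEvent ↑S (edgeBallL r u (i :: u) ∩ A) y)
      = μ (treeCylEvent ↑S (edgeBallL r u (i :: u) ∩ A) y ∩ treeCylEvent ∅ ↑F₁ y)
        * μ (treeCylEvent ↑S (edgeBallL r u (i :: u) ∩ A) y ∩ treeCylEvent ∅ ↑F₂ y)

/-- A random colored tree is `r`-Markov if the above holds with ambient set everything. -/
def rMarkovTree [MeasurableSpace M] (r : ℕ) (μ : Measure (RCG M)) : Prop :=
  rMarkovTreeOn r Set.univ μ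

/-- A random colored tree is vertex-Markov on the ambient set `A` if, conditioned on the tree
and on the value at a vertex, the processes on the pending subtrees of that vertex are
independent. -/
def vertexMarkovTreeOn [MeasurableSpace M] (A : Set (List ℕ)) (μ : Measure (RCG M)) :
    Prop :=
  ∀ v ∈ A, ∀ (k : ℕ) (u : Fin k → List ℕ), Function.Injective u →
    (∀ j, u j ∈ A ∧ ((∃ i, 1 ≤ i ∧ u j = i :: v) ∨ (v ≠ [] ∧ u j = v.tail))) →
    ∀ F : Fin k → Finset (List ℕ), (∀ j, ↑(F j) ⊆ sideL (u j) v ∩ A) →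
    ∀ S : Finset (List ℕ), ↑S ⊆ A → ∀ y : RCG M,
      μ (treeCylEvent ↑S {v} y ∩ ⋂ j, treeCylEvent ∅ ↑(F j) y)
          * (μ (treeCylEvent ↑S {v} y)) ^ (k - 1)
        = ∏ j : Fin k, μ (treeCylEvent ↑S {v} y ∩ treeCylEvent ∅ ↑(F j) y)

/-- A random colored tree is vertex-Markov if the above holds with ambient set everything. -/
def vertexMarkovTree [MeasurableSpace M] (μ : Measure (RCG M)) : Prop :=
  vertexMarkovTreeOn Set.univ μ

/-! ### Random graphs with given degree sequences -/

/-- The set of simple graphs on `{1,…,n}` with degree sequence `dn`. -/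
def degSeqGraphs (n : ℕ) (dn : Fin n → ℕ) : Set (SimpleGraph (Fin n)) :=
  {G | ∀ v, (G.neighborSet v).ncard = dn v}

/-- The probability that a uniform random graph with degree sequence `dn` lies in `A`. -/
def PrD (n : ℕ) (dn : Fin n → ℕ) (A : Set (SimpleGraph (Fin n))) : ℝ :=
  ((degSeqGraphs n dn ∩ A).ncard : ℝ) / ((degSeqGraphs n dn).ncard : ℝ)

/-- `𝓕_G(μ,r,ε)` for a process `μ` over a unimodular Galton-Watson tree. -/
def FSetD [MeasurableSpace M] (μ : Measure (RCG M)) (r : ℕ) (ε : ℝ) {n : ℕ}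
    (G : SimpleGraph (Fin n)) : Set (Fin n → M) :=
  {f | levyProkhorovDist ((distrG G f).map (resS r)) (μ.map (resS r)) ≤ ε}

/-- `H_G(μ,r,ε) = (1/n) log |𝓕_G(μ,r,ε)|`. -/
def HGD [MeasurableSpace M] (μ : Measure (RCG M)) (r : ℕ) (ε : ℝ) {n : ℕ}
    (G : SimpleGraph (Fin n)) : EReal :=
  if FSetD μ r ε G = ∅ then ⊥
  else ((Real.log ((FSetD μ r ε G).ncard) / n : ℝ) : EReal)

/-- The `α`-quantile of `H_{G_n}(μ,r,ε)` for the uniform random graph with degree sequence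
`DN n`. -/
def hquantD [MeasurableSpace M] (DN : (n : ℕ) → Fin n → ℕ) (μ : Measure (RCG M)) (r : ℕ)
    (ε : ℝ) (α : ℝ) (n : ℕ) : EReal :=
  sSup {h : EReal | (h = ⊥ ∨ 0 ≤ h) ∧
    α ≤ PrD n (DN n) {G : SimpleGraph (Fin n) | h ≤ HGD μ r ε G}}

/-- `h̄(μ,r,α)` for the degree-sequence ensemble. -/
def hbarAD [MeasurableSpace M] (DN : (n : ℕ) → Fin n → ℕ) (μ : Measure (RCG M)) (r : ℕ)
    (α : ℝ) : EReal :=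
  ⨅ ε : {e : ℝ // 0 < e}, Filter.atTop.limsup (fun n => hquantD DN μ r ε.1 α n)

/-- `h̲(μ,r,α)` for the degree-sequence ensemble. -/
def hlowAD [MeasurableSpace M] (DN : (n : ℕ) → Fin n → ℕ) (μ : Measure (RCG M)) (r : ℕ)
    (α : ℝ) : EReal :=
  ⨅ ε : {e : ℝ // 0 < e}, Filter.atTop.liminf (fun n => hquantD DN μ r ε.1 α n)

/-- `h̄(μ,r)`: the common value of `h̄(μ,r,α)`, `0 < α < 1`. -/
def hbarRD [MeasurableSpace M] (DN : (n : ℕ) → Fin n → ℕ) (μ : Measure (RCG M)) (r : ℕ) :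
    EReal :=
  hbarAD DN μ r (1 / 2)

/-- `h̲(μ,r)`. -/
def hlowRD [MeasurableSpace M] (DN : (n : ℕ) → Fin n → ℕ) (μ : Measure (RCG M)) (r : ℕ) :
    EReal :=
  hlowAD DN μ r (1 / 2)

/-- The upper sofic entropy `h̄(μ) = lim_{r → ∞} h̄(μ,r)`. -/
def hbarD [MeasurableSpace M] (DN : (n : ℕ) → Fin n → ℕ) (μ : Measure (RCG M)) : EReal :=
  ⨅ r : ℕ, hbarRD DN μ r

/-- The lower sofic entropy `h̲(μ) = lim_{r → ∞} h̲(μ,r)`. -/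
def hlowD [MeasurableSpace M] (DN : (n : ℕ) → Fin n → ℕ) (μ : Measure (RCG M)) : EReal :=
  ⨅ r : ℕ, hlowRD DN μ r

/-- The hypotheses on the degree sequences: uniformly bounded by `Δ`, even sums, and
empirical distributions converging (weakly) to `π`. -/
def GoodDegSeq (π : ℕ → ℝ) (Δ : ℝ) (DN : (n : ℕ) → Fin n → ℕ) : Prop :=
  (∀ n v, (DN n v : ℝ) ≤ Δ) ∧ (∀ n, Even (∑ v : Fin n, DN n v)) ∧
  (∀ k : ℕ, Tendsto (fun n => (((Finset.univ.filter (fun v : Fin n => DN n v = k)).card : ℝ) / n))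
    atTop (nhds (π k)))

/-- The hypotheses on the degree distribution `π`: a probability mass function supported in
`{0,…,Δ}` with mean `dd > 0`. -/
def GoodPmf (π : ℕ → ℝ) (Δ : ℝ) (dd : ℝ) : Prop :=
  (∀ k, 0 ≤ π k) ∧ (∑' k : ℕ, π k) = 1 ∧ (∀ k : ℕ, (Δ : ℝ) < k → π k = 0) ∧
  (∑' k : ℕ, (k : ℝ) * π k) = dd ∧ 0 < dd


/-! ### Couplings -/

/-- `ν ∈ I_d(M × M)` is an invariant coupling of `μ` with itself: both coordinate marginal
processes of `ν` have law `μ`. -/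
def IsInvCoupling (d : ℕ) {M : Type*} [MeasurableSpace M] (μ : Measure (TdVertex d → M))
    (ν : Measure (TdVertex d → M × M)) : Prop :=
  ν ∈ InvMeas d (M × M) ∧ ν.map (fun x => fun v => (x v).1) = μ ∧
    ν.map (fun x => fun v => (x v).2) = μ

/-- The first coordinate marginal of a colored graph with colors in a product set. -/
def rcgFst {M₁ M₂ : Type*} (g : RCG (M₁ × M₂)) : RCG M₁ :=
  ⟨fun l => (g.col l).map Prod.fst, g.adj⟩

/-- The second coordinate marginal of a colored graph with colors in a product set. -/
def rcgSnd {M₁ M₂ : Type*} (g : RCG (M₁ × M₂)) : RCG M₂ :=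
  ⟨fun l => (g.col l).map Prod.snd, g.adj⟩

/-- `ν ∈ I_π(M × M)` is an invariant coupling of `μ ∈ I_π(M)` with itself. -/
def IsInvCouplingUGW (π : ℕ → ℝ) (dd : ℝ) {M : Type*} [MeasurableSpace M]
    (μ : Measure (RCG M)) (ν : Measure (RCG (M × M))) : Prop :=
  ν ∈ IPiMeas π dd (M × M) ∧ ν.map rcgFst = μ ∧ ν.map rcgSnd = μ


/-! ### Concentration for uniform random permutations -/

lemma decomposeFin_symm_mul_swap {N : ℕ} (p : Fin (N + 1)) (e : Equiv.Perm (Fin N))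
    (i j : Fin N) :
    Equiv.Perm.decomposeFin.symm (p, e * Equiv.swap i j)
      = Equiv.Perm.decomposeFin.symm (p, e) * Equiv.swap i.succ j.succ := by
  ext x
  congr 1
  refine Fin.cases ?_ (fun x => ?_) x
  · rw [Equiv.Perm.mul_apply, Equiv.swap_apply_of_ne_of_ne (Fin.succ_ne_zero i).symm
      (Fin.succ_ne_zero j).symm]
    simp only [Equiv.Perm.decomposeFin_symm_apply_zero]
  · have h : Equiv.swap i.succ j.succ x.succ = (Equiv.swap i j x).succ := by
      simp only [Equiv.swap_apply_def, Fin.succ_inj]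
      split_ifs <;> rfl
    rw [Equiv.Perm.mul_apply, h, Equiv.Perm.decomposeFin_symm_apply_succ,
      Equiv.Perm.decomposeFin_symm_apply_succ, Equiv.Perm.mul_apply]

lemma decomposeFin_symm_eq_swap_mul {N : ℕ} (p q : Fin (N + 1)) (e : Equiv.Perm (Fin N)) :
    Equiv.Perm.decomposeFin.symm (q, e)
      = Equiv.swap 0 q * (Equiv.swap 0 p * Equiv.Perm.decomposeFin.symm (p, e)) := by
  ext x
  congr 1
  refine Fin.cases ?_ (fun x => ?_) x
  · simp
  · simp [Equiv.Perm.decomposeFin_symm_apply_succ]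

/-- For a function on permutations which varies by at most `L` under transpositions, the
exponential moments of `f` and `-f` satisfy a sub-Gaussian product bound. -/
lemma sum_exp_mul_sum_exp_neg_le (N : ℕ) (L : ℝ) (f : Equiv.Perm (Fin N) → ℝ)
    (hf : ∀ σ i j, f (σ * Equiv.swap i j) ≤ f σ + L) :
    (∑ σ, Real.exp (f σ)) * (∑ σ, Real.exp (-f σ))
      ≤ (N.factorial : ℝ) ^ 2 * Real.exp (2 * N * L ^ 2) := by
  induction N with
  | zero =>
    rw [Fintype.sum_unique, Fintype.sum_unique, ← Real.exp_add]
    simp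
  | succ N ih =>
    set D := (Equiv.Perm.decomposeFin (n := N)).symm with hD
    have hL : 0 ≤ L := by
      have := hf 1 0 0
      simp only [Equiv.swap_self] at this
      have h1 : (1 : Equiv.Perm (Fin (N + 1))) * Equiv.refl _ = 1 := rfl
      rw [h1] at this
      linarith
    have hleft : ∀ σ i j, f (Equiv.swap i j * σ) ≤ f σ + L := by
      intro σ i j
      have : Equiv.swap i j * σ = σ * Equiv.swap (σ⁻¹ i) (σ⁻¹ j) := by
        rw [Equiv.mul_swap_eq_swap_mul]; simp
      rw [this]
      exact hf _ _ _
    have hpq : ∀ p q e, f (D (q, e)) ≤ f (D (p, e)) + 2 * L := by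
      intro p q e
      rw [hD, decomposeFin_symm_eq_swap_mul p q e]
      have h1 := hleft (Equiv.swap 0 p * Equiv.Perm.decomposeFin.symm (p, e)) 0 q
      have h2 := hleft (Equiv.Perm.decomposeFin.symm (p, e)) 0 p
      linarith
    set A : Fin (N + 1) → ℝ := fun p => ∑ e, Real.exp (f (D (p, e))) with hA
    set B : Fin (N + 1) → ℝ := fun p => ∑ e, Real.exp (-f (D (p, e))) with hB
    have hAp : ∀ p, 0 < A p := fun p =>
      Finset.sum_pos (fun _ _ => Real.exp_pos _) Finset.univ_nonempty
    have hBp : ∀ p, 0 < B p := fun p =>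
      Finset.sum_pos (fun _ _ => Real.exp_pos _) Finset.univ_nonempty
    set K : ℝ := (N.factorial : ℝ) ^ 2 * Real.exp (2 * N * L ^ 2) with hK
    have hKp : 0 < K := by positivity
    have hAB : ∀ p, A p * B p ≤ K := fun p => by
      refine ih (fun e => f (D (p, e))) (fun e i j => ?_)
      simp only [hD]
      rw [decomposeFin_symm_mul_swap]
      exact hf _ _ _
    have hratio : ∀ p q, A q ≤ Real.exp (2 * L) * A p := by
      intro p q
      rw [hA, Finset.mul_sum]
      refine Finset.sum_le_sum fun e _ => ?_
      rw [← Real.exp_add]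
      exact Real.exp_le_exp.2 (by linarith [hpq p q e])
    have hpair : ∀ p q, A p * B q + A q * B p ≤ 2 * (K * Real.exp (2 * L ^ 2)) := by
      intro p q
      set u := Real.log (A p / A q) with hu
      have hx : 0 < A p / A q := div_pos (hAp p) (hAp q)
      have hexp : Real.exp u = A p / A q := Real.exp_log hx
      have hexp' : Real.exp (-u) = A q / A p := by rw [Real.exp_neg, hexp, inv_div]
      have hu1 : u ≤ 2 * L := by
        rw [hu, Real.log_le_iff_le_exp hx, div_le_iff₀ (hAp q)]
        exact hratio q p
      have hu2 : -(2 * L) ≤ u := by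
        have : -u ≤ 2 * L := by
          rw [← Real.exp_le_exp, hexp', div_le_iff₀ (hAp p)]
          exact hratio p q
        linarith
      have h1 : A p * B q ≤ K * Real.exp u := by
        rw [hexp]
        have : A p * B q = (A q * B q) * (A p / A q) := by
          field_simp [(hAp q).ne']
        rw [this]
        exact mul_le_mul_of_nonneg_right (hAB q) hx.le
      have h2 : A q * B p ≤ K * Real.exp (-u) := by
        rw [hexp']
        have : A q * B p = (A p * B p) * (A q / A p) := by
          field_simp [(hAp p).ne']
        rw [this]
        exact mul_le_mul_of_nonneg_right (hAB p) (div_pos (hAp q) (hAp p)).le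
      have h3 : Real.exp u + Real.exp (-u) ≤ 2 * Real.exp (2 * L ^ 2) := by
        have h4 := Real.cosh_le_exp_half_sq u
        have h5 : Real.exp (u ^ 2 / 2) ≤ Real.exp (2 * L ^ 2) :=
          Real.exp_le_exp.2 (by nlinarith)
        rw [Real.cosh_eq] at h4
        linarith
      nlinarith
    have hsA : ∑ σ, Real.exp (f σ) = ∑ p, A p := by
      rw [← Equiv.sum_comp D, Fintype.sum_prod_type]
    have hsB : ∑ σ, Real.exp (-f σ) = ∑ p, B p := by
      rw [← Equiv.sum_comp D, Fintype.sum_prod_type]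
    have hsum : 2 * ((∑ p, A p) * (∑ q, B q))
        ≤ ∑ _p : Fin (N + 1), ∑ _q : Fin (N + 1), 2 * (K * Real.exp (2 * L ^ 2)) := by
      have e1 : (∑ p, A p) * (∑ q, B q) = ∑ p, ∑ q, A p * B q := Finset.sum_mul_sum _ _ _ _
      have e2 : (∑ p, A p) * (∑ q, B q) = ∑ p, ∑ q, A q * B p := by
        rw [e1, Finset.sum_comm]
      calc 2 * ((∑ p, A p) * (∑ q, B q))
          = ∑ p, ∑ q, (A p * B q + A q * B p) := by
            simp only [Finset.sum_add_distrib]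
            rw [two_mul]
            conv_lhs => rw [e1]
            rw [← e1, ← e2]
        _ ≤ _ := Finset.sum_le_sum fun p _ => Finset.sum_le_sum fun q _ => hpair p q
    rw [hsA, hsB]
    simp only [Finset.sum_const, Finset.card_univ, Fintype.card_fin, nsmul_eq_mul] at hsum
    have hexp : Real.exp (2 * ((N + 1 : ℕ) : ℝ) * L ^ 2)
        = Real.exp (2 * N * L ^ 2) * Real.exp (2 * L ^ 2) := by
      rw [← Real.exp_add]; push_cast; ring_nf
    rw [hexp, Nat.factorial_succ]
    push_cast at hsum ⊢
    calc (∑ p, A p) * (∑ q, B q)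
        ≤ ((N : ℝ) + 1) * (((N : ℝ) + 1) * (K * Real.exp (2 * L ^ 2))) := by linarith
      _ = _ := by rw [hK]; ring

/-- The Hamming distance between two permutations. -/
def permHam {X : Type*} [Fintype X] [DecidableEq X] (σ τ : Equiv.Perm X) : ℕ :=
  (Finset.univ.filter fun x => σ x ≠ τ x).card

lemma permHam_mul_swap_le {X : Type*} [Fintype X] [DecidableEq X] (σ τ : Equiv.Perm X) (i j : X) :
    permHam (σ * Equiv.swap i j) τ ≤ permHam σ τ + 2 := by
  have h : (Finset.univ.filter fun x => (σ * Equiv.swap i j) x ≠ τ x)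
      ⊆ (Finset.univ.filter fun x => σ x ≠ τ x) ∪ {i, j} := by
    intro x hx
    by_cases h : x ∈ ({i, j} : Finset X)
    · exact Finset.mem_union_right _ h
    · refine Finset.mem_union_left _ ?_
      simp only [Finset.mem_insert, Finset.mem_singleton, not_or] at h
      rw [Finset.mem_filter] at hx ⊢
      rwa [Equiv.Perm.mul_apply, Equiv.swap_apply_of_ne_of_ne h.1 h.2] at hx
  refine (Finset.card_le_card h).trans ((Finset.card_union_le _ _).trans ?_)
  exact Nat.add_le_add_left Finset.card_le_two _

/-- Two sets of permutations at Hamming distance at least `t` cannot both be large. -/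
lemma card_mul_card_le_of_permHam {N : ℕ} (A B : Finset (Equiv.Perm (Fin N))) (t : ℝ)
    (ht : 0 ≤ t) (h : ∀ σ ∈ B, ∀ τ ∈ A, t ≤ permHam σ τ) :
    (A.card : ℝ) * B.card
      ≤ (N.factorial : ℝ) ^ 2 * Real.exp (-(t ^ 2 / (32 * N))) := by
  rcases A.eq_empty_or_nonempty with rfl | hA
  · simp; positivity
  set lam : ℝ := t / (16 * N) with hlam
  have hlam0 : 0 ≤ lam := by positivity
  obtain ⟨m, hmin, hatt⟩ : ∃ m : Equiv.Perm (Fin N) → ℕ,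
      (∀ σ, ∀ τ ∈ A, m σ ≤ permHam σ τ) ∧ ∀ σ, ∃ τ ∈ A, permHam σ τ = m σ :=
    ⟨fun σ => A.inf' hA (permHam σ), fun σ τ hτ => Finset.inf'_le _ hτ, fun σ =>
      (A.exists_mem_eq_inf' hA (permHam σ)).imp fun τ hτ => ⟨hτ.1, hτ.2.symm⟩⟩
  have hmL : ∀ σ i j, m (σ * Equiv.swap i j) ≤ m σ + 2 := by
    intro σ i j
    obtain ⟨τ, hτ, he⟩ := hatt σ
    have h1 := hmin (σ * Equiv.swap i j) τ hτ
    have h2 := permHam_mul_swap_le σ τ i j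
    rw [he] at h2
    exact le_trans h1 h2
  have key := sum_exp_mul_sum_exp_neg_le N (2 * lam) (fun σ => lam * m σ) (fun σ i j => by
    have : (m (σ * Equiv.swap i j) : ℝ) ≤ m σ + 2 := by exact_mod_cast hmL σ i j
    nlinarith)
  have hAle : (A.card : ℝ) ≤ ∑ σ, Real.exp (-(lam * m σ)) := by
    calc (A.card : ℝ) = ∑ σ ∈ A, (1 : ℝ) := by simp
      _ ≤ ∑ σ ∈ A, Real.exp (-(lam * m σ)) := by
        refine Finset.sum_le_sum fun σ hσ => ?_
        have h0 : m σ = 0 := by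
          have h1 : m σ ≤ permHam σ σ := hmin σ σ hσ
          have h2 : permHam σ σ = 0 := by simp [permHam]
          omega
        simp [h0]
      _ ≤ _ := Finset.sum_le_sum_of_subset_of_nonneg (Finset.subset_univ _)
        fun _ _ _ => (Real.exp_pos _).le
  have hBle : (B.card : ℝ) * Real.exp (lam * t) ≤ ∑ σ, Real.exp (lam * m σ) := by
    calc (B.card : ℝ) * Real.exp (lam * t) = ∑ σ ∈ B, Real.exp (lam * t) := by simp
      _ ≤ ∑ σ ∈ B, Real.exp (lam * m σ) := by
        refine Finset.sum_le_sum fun σ hσ => Real.exp_le_exp.2 ?_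
        refine mul_le_mul_of_nonneg_left ?_ hlam0
        obtain ⟨τ, hτ, he⟩ := hatt σ
        rw [← he]
        exact h σ hσ τ hτ
      _ ≤ _ := Finset.sum_le_sum_of_subset_of_nonneg (Finset.subset_univ _)
        fun _ _ _ => (Real.exp_pos _).le
  have hmul : (A.card : ℝ) * B.card * Real.exp (lam * t)
      ≤ (N.factorial : ℝ) ^ 2 * Real.exp (2 * N * (2 * lam) ^ 2) := by
    refine le_trans ?_ key
    rw [mul_comm (∑ σ, _)]
    rw [mul_assoc]
    exact mul_le_mul hAle hBle (by positivity) (Finset.sum_nonneg fun _ _ => (Real.exp_pos _).le)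
  have hfin : 2 * N * (2 * lam) ^ 2 - lam * t = -(t ^ 2 / (32 * N)) := by
    rcases Nat.eq_zero_or_pos N with rfl | hN
    · simp [hlam]
    · have : (N : ℝ) ≠ 0 := by positivity
      rw [hlam]; field_simp; ring
  rw [← hfin, Real.exp_sub, ← mul_div_assoc, le_div_iff₀ (Real.exp_pos _)]
  exact hmul

/-! ### The configuration model -/

/-- The simple graph obtained from a labelling `ρ` of half-edges by vertices, the half-edges
being matched by `ι`. -/
def pairGraph {X V : Type*} (ι : X → X) (hι : Function.Involutive ι) (ρ : X → V) :
    SimpleGraph V where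
  Adj v w := v ≠ w ∧ ∃ x, ρ x = v ∧ ρ (ι x) = w
  symm := ⟨fun _ _ ⟨h, x, h1, h2⟩ => ⟨h.symm, ι x, h2, by rw [hι x, h1]⟩⟩
  loopless := ⟨fun _ h => h.1 rfl⟩

lemma neighborSet_pairGraph_subset {X : Type*} [Fintype X] {n : ℕ} {ι : X → X}
    (hι : Function.Involutive ι) (ρ : X → Fin n) (v : Fin n) :
    (pairGraph ι hι ρ).neighborSet v
      ⊆ ↑((Finset.univ.filter fun x => ρ x = v).image fun x => ρ (ι x)) := by
  rintro w ⟨-, x, h1, h2⟩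
  simp only [Finset.coe_image, Set.mem_image, Finset.mem_coe, Finset.mem_filter,
    Finset.mem_univ, true_and]
  exact ⟨x, h1, h2⟩

lemma dart_injective_of_regular {X : Type*} [Fintype X] {n d : ℕ} {ι : X → X}
    (hι : Function.Involutive ι) {ρ : X → Fin n}
    (hρ : ∀ v, (Finset.univ.filter fun x => ρ x = v).card = d)
    (hG : pairGraph ι hι ρ ∈ regularGraphs d n) :
    Function.Injective fun x => (ρ x, ρ (ι x)) := by
  intro x y hxy
  simp only [Prod.mk.injEq] at hxy
  set F := Finset.univ.filter fun z => ρ z = ρ x with hF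
  have h1 : d ≤ (F.image fun z => ρ (ι z)).card := by
    have h2 := Set.ncard_le_ncard (neighborSet_pairGraph_subset hι ρ (ρ x))
      (Finset.finite_toSet _)
    rw [hG (ρ x), Set.ncard_coe_finset] at h2
    exact h2
  have h3 : (F.image fun z => ρ (ι z)).card = F.card :=
    le_antisymm Finset.card_image_le (by rw [hF, hρ]; exact h1)
  have h4 := Finset.card_image_iff.1 h3
  exact h4 (by simp [hF]) (by simp [hF, hxy.1]) hxy.2

lemma regular_of_dart_injective {X : Type*} [Fintype X] {n d : ℕ} {ι : X → X}
    (hι : Function.Involutive ι) (hfix : ∀ x, ι x ≠ x) {ρ : X → Fin n}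
    (hρ : ∀ v, (Finset.univ.filter fun x => ρ x = v).card = d)
    (hinj : Function.Injective fun x => (ρ x, ρ (ι x))) :
    pairGraph ι hι ρ ∈ regularGraphs d n := by
  intro v
  have h1 : (pairGraph ι hι ρ).neighborSet v
      = ↑((Finset.univ.filter fun x => ρ x = v).image fun x => ρ (ι x)) := by
    refine (neighborSet_pairGraph_subset hι ρ v).antisymm ?_
    intro w hw
    simp only [Finset.coe_image, Set.mem_image, Finset.mem_coe, Finset.mem_filter,
      Finset.mem_univ, true_and] at hw
    obtain ⟨x, hx, hw⟩ := hw
    refine ⟨fun hvw => hfix x ?_, x, hx, hw⟩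
    apply hinj
    simp only [Prod.mk.injEq]
    rw [hι x, hw, hx, hvw]
    exact ⟨rfl, rfl⟩
  rw [h1, Set.ncard_coe_finset, Finset.card_image_of_injOn, hρ]
  intro x hx y hy hxy
  simp only [Finset.coe_filter, Finset.mem_univ, true_and, Set.mem_ofPred_eq] at hx hy
  exact hinj (Prod.ext (hx.trans hy.symm) hxy)

lemma adj_of_dart_injective {X V : Type*} {ι : X → X}
    (hι : Function.Involutive ι) (hfix : ∀ x, ι x ≠ x) {ρ : X → V}
    (hinj : Function.Injective fun x => (ρ x, ρ (ι x))) (x : X) :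
    (pairGraph ι hι ρ).Adj (ρ x) (ρ (ι x)) := by
  refine ⟨fun h => hfix x ?_, x, rfl, rfl⟩
  apply hinj
  simp only [Prod.mk.injEq]
  rw [hι x, h]
  exact ⟨rfl, rfl⟩

/-- All regular graphs arising from the configuration model have the same number of
representations. -/
lemma card_pairGraph_eq {X : Type*} [Fintype X] [DecidableEq X] {n d : ℕ} {ι : X → X}
    (hι : Function.Involutive ι) (hfix : ∀ x, ι x ≠ x) {π : X → Fin n}
    (hπ : ∀ v, (Finset.univ.filter fun x => π x = v).card = d) (σ₁ : Equiv.Perm X)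
    (hG : pairGraph ι hι (π ∘ σ₁) ∈ regularGraphs d n) :
    (Finset.univ.filter fun σ : Equiv.Perm X =>
        pairGraph ι hι (π ∘ σ) = pairGraph ι hι (π ∘ σ₁)).card
      = ((Finset.univ.filter fun k : Equiv.Perm X => ∀ x, π (k x) = π x) ×ˢ
        (Finset.univ.filter fun c : Equiv.Perm X => ∀ x, c (ι x) = ι (c x))).card := by
  have hfib : ∀ σ : Equiv.Perm X, ∀ v,
      (Finset.univ.filter fun x => (π ∘ σ) x = v).card = d := by
    intro σ v
    rw [← hπ v]
    refine Finset.card_bij (fun x _ => σ x) (by simp) (by simp) fun y hy => ⟨σ.symm y, ?_, ?_⟩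
    · simpa using hy
    · simp
  have hinj₁ := dart_injective_of_regular hι (hfib σ₁) hG
  symm
  refine Finset.card_bij (fun p _ => p.1 * σ₁ * p.2) ?_ ?_ ?_
  · rintro ⟨k, c⟩ h
    simp only [Finset.mem_product, Finset.mem_filter, Finset.mem_univ, true_and] at h ⊢
    ext v w
    simp only [pairGraph, Function.comp_apply, Equiv.Perm.mul_apply, h.1, h.2]
    refine and_congr_right fun _ => ⟨?_, ?_⟩
    · rintro ⟨x, h1, h2⟩
      exact ⟨c x, h1, h2⟩
    · rintro ⟨x, h1, h2⟩
      exact ⟨c.symm x, by simpa using h1, by simpa using h2⟩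
  · rintro ⟨k, c⟩ h ⟨k', c'⟩ h' he
    simp only [Finset.mem_product, Finset.mem_filter, Finset.mem_univ, true_and] at h h' he
    have h1 : ∀ x, π (σ₁ (c x)) = π (σ₁ (c' x)) := by
      intro x
      have := congrArg π (Equiv.congr_fun he x)
      simpa only [Equiv.Perm.mul_apply, h.1, h'.1] using this
    have hc : c = c' := by
      ext x
      apply hinj₁
      simp only [Function.comp_apply, Prod.mk.injEq]
      refine ⟨h1 x, ?_⟩
      rw [← h.2, ← h'.2]
      exact h1 _
    subst hc
    have hk : k = k' := by
      have := mul_right_cancel he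
      exact mul_right_cancel this
    rw [hk]
  · intro σ hσ
    simp only [Finset.mem_filter, Finset.mem_univ, true_and] at hσ
    have hinj := dart_injective_of_regular hι (hfib σ) (by rw [hσ]; exact hG)
    have hex : ∀ x, ∃ y, π (σ₁ y) = π (σ x) ∧ π (σ₁ (ι y)) = π (σ (ι x)) := by
      intro x
      have h1 := adj_of_dart_injective hι hfix hinj x
      rw [hσ] at h1
      obtain ⟨-, y, h2, h3⟩ := h1
      exact ⟨y, h2, h3⟩
    choose c₀ h1 h2 using hex
    have hc₀ : Function.Injective c₀ := by
      intro x y hxy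
      apply hinj
      simp only [Function.comp_apply, Prod.mk.injEq]
      rw [← h1, ← h1, ← h2, ← h2, hxy]
      exact ⟨rfl, rfl⟩
    set c : Equiv.Perm X := Equiv.ofBijective c₀ (Finite.injective_iff_bijective.1 hc₀) with hc
    have hcap : ∀ x, c x = c₀ x := fun x => rfl
    refine ⟨(σ * c⁻¹ * σ₁⁻¹, c), ?_, ?_⟩
    · simp only [Finset.mem_product, Finset.mem_filter, Finset.mem_univ, true_and]
      constructor
      · intro x
        simp only [Equiv.Perm.mul_apply]
        rw [← h1, ← hcap]
        simp
      · intro x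
        apply hinj₁
        simp only [Function.comp_apply, Prod.mk.injEq, hcap]
        rw [h1, h2, hι, h2, h1, hι]
        exact ⟨rfl, rfl⟩
    · simp [mul_assoc]

lemma isConj_of_involutive {X : Type*} [Fintype X] [DecidableEq X] [Nonempty X]
    {ι j : X → X} (hι : Function.Involutive ι) (hfix : ∀ x, ι x ≠ x)
    (hj : Function.Involutive j) (hjfix : ∀ x, j x ≠ x) :
    IsConj hι.toPerm hj.toPerm := by
  have key : ∀ {k : X → X} (hk : Function.Involutive k), (∀ x, k x ≠ x) →
      ∃ m, hk.toPerm.cycleType = Multiset.replicate (m + 1) 2 ∧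
        2 * (m + 1) = Fintype.card X := by
    intro k hk hkf
    have hord : orderOf hk.toPerm = 2 := by
      refine orderOf_eq_prime (Equiv.ext fun x => ?_) fun h => ?_
      · simpa [pow_two] using hk x
      · exact hkf (Classical.arbitrary X) (Equiv.congr_fun h _)
    obtain ⟨m, hm⟩ := Equiv.Perm.cycleType_prime_order (σ := hk.toPerm)
      (by rw [hord]; exact Nat.prime_two)
    rw [hord] at hm
    refine ⟨m, hm, ?_⟩
    have h1 := Equiv.Perm.sum_cycleType hk.toPerm
    have h2 : hk.toPerm.support = Finset.univ := by
      ext x; simpa using hkf x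
    rw [hm, h2, Multiset.sum_replicate, Finset.card_univ] at h1
    rw [← h1]; simp [mul_comm]
  rw [Equiv.Perm.isConj_iff_cycleType_eq]
  obtain ⟨m, h1, h2⟩ := key hι hfix
  obtain ⟨m', h1', h2'⟩ := key hj hjfix
  rw [h1, h1', show m = m' by omega]

/-- Every regular graph arises from the configuration model. -/
lemma exists_pairGraph_eq {X : Type*} [Fintype X] [DecidableEq X] [Nonempty X] {n d : ℕ}
    {ι : X → X} (hι : Function.Involutive ι) (hfix : ∀ x, ι x ≠ x) {π : X → Fin n}
    (hπ : ∀ v, (Finset.univ.filter fun x => π x = v).card = d) {G : SimpleGraph (Fin n)}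
    (hG : G ∈ regularGraphs d n) : ∃ σ : Equiv.Perm X, pairGraph ι hι (π ∘ σ) = G := by
  have hcard : ∀ v, Nonempty ({x // π x = v} ≃ {a : G.Dart // a.fst = v}) := by
    intro v
    refine ⟨Fintype.equivOfCardEq ?_⟩
    rw [Fintype.card_subtype, hπ v, Fintype.card_subtype, G.dart_fst_fiber_card_eq_degree v,
      ← G.card_neighborSet_eq_degree, ← hG v, Set.ncard_eq_toFinset_card',
      Set.toFinset_card]
  have e := fun v => (hcard v).some
  let β : X ≃ G.Dart := (Equiv.sigmaFiberEquiv π).symm.trans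
    ((Equiv.sigmaCongrRight e).trans (Equiv.sigmaFiberEquiv fun a : G.Dart => a.fst))
  have hβ : ∀ x, (β x).fst = π x := fun x => (e (π x) ⟨x, rfl⟩).2
  let j : X → X := fun x => β.symm (β x).symm
  have hj : Function.Involutive j := fun x => by simp [j]
  have hjfix : ∀ x, j x ≠ x := by
    intro x h
    have : (β x).symm = β x := by
      conv_rhs => rw [← h]
      simp [j]
    exact SimpleGraph.Dart.symm_ne _ this
  obtain ⟨σ, hσ⟩ := isConj_iff.1 (isConj_of_involutive hι hfix hj hjfix)
  have hσι : ∀ x, σ (ι x) = j (σ x) := by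
    intro x
    have := Equiv.congr_fun hσ (σ x)
    simpa using this
  have hπj : ∀ x, π (j x) = (β x).snd := by
    intro x
    rw [← hβ]
    simp [j]
  refine ⟨σ, ?_⟩
  ext v w
  constructor
  · rintro ⟨-, x, rfl, rfl⟩
    simp only [Function.comp_apply]
    rw [hσι, hπj, ← hβ]
    exact (β (σ x)).adj
  · intro h
    refine ⟨h.ne, σ.symm (β.symm ⟨(v, w), h⟩), ?_, ?_⟩
    · simp [← hβ]
    · simp [hσι, hπj]

lemma card_sdiff_mul_card_coincidence_le {X V : Type*} [Fintype X] [DecidableEq X]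
    [DecidableEq V] {d : ℕ}
    {π : X → V} (hπ : ∀ v, (Finset.univ.filter fun x => π x = v).card = d) (x y : X)
    (S : Finset X) (hx : x ∈ S) (hy : y ∉ S) (Q : Equiv.Perm X → Prop)
    (hQ : ∀ σ z, z ∉ S → (Q (σ * Equiv.swap y z) ↔ Q σ)) :
    (Fintype.card X - S.card) *
        (Finset.univ.filter fun σ : Equiv.Perm X => π (σ x) = π (σ y) ∧ Q σ).card
      ≤ d * (Finset.univ.filter Q).card := by
  have h1 : ∀ z ∈ Sᶜ, (Finset.univ.filter fun σ : Equiv.Perm X => π (σ x) = π (σ y) ∧ Q σ).card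
      = (Finset.univ.filter fun σ : Equiv.Perm X => π (σ x) = π (σ z) ∧ Q σ).card := by
    intro z hz
    rw [Finset.mem_compl] at hz
    have hxy : x ≠ y := fun h => hy (h ▸ hx)
    have hxz : x ≠ z := fun h => hz (h ▸ hx)
    refine Finset.card_bij (fun σ _ => σ * Equiv.swap y z) ?_ ?_ ?_
    · intro σ h
      simp only [Finset.mem_filter, Finset.mem_univ, true_and] at h ⊢
      rw [hQ σ z hz, Equiv.Perm.mul_apply, Equiv.Perm.mul_apply,
        Equiv.swap_apply_of_ne_of_ne hxy hxz, Equiv.swap_apply_right]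
      exact h
    · intro σ _ τ _ h
      exact mul_right_cancel h
    · intro σ h
      simp only [Finset.mem_filter, Finset.mem_univ, true_and] at h
      refine ⟨σ * Equiv.swap y z, ?_, by simp [mul_assoc]⟩
      simp only [Finset.mem_filter, Finset.mem_univ, true_and]
      rw [hQ σ z hz, Equiv.Perm.mul_apply, Equiv.Perm.mul_apply,
        Equiv.swap_apply_of_ne_of_ne hxy hxz, Equiv.swap_apply_left]
      exact h
  have h2 : (Fintype.card X - S.card) *
        (Finset.univ.filter fun σ : Equiv.Perm X => π (σ x) = π (σ y) ∧ Q σ).card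
      = ∑ z ∈ Sᶜ, (Finset.univ.filter fun σ : Equiv.Perm X =>
          π (σ x) = π (σ z) ∧ Q σ).card := by
    rw [← Finset.sum_congr rfl h1, Finset.sum_const, Finset.card_compl, smul_eq_mul]
  rw [h2]
  calc ∑ z ∈ Sᶜ, (Finset.univ.filter fun σ : Equiv.Perm X => π (σ x) = π (σ z) ∧ Q σ).card
      ≤ ∑ z : X, (Finset.univ.filter fun σ : Equiv.Perm X => π (σ x) = π (σ z) ∧ Q σ).card :=
        Finset.sum_le_sum_of_subset (Finset.subset_univ _)
    _ = ∑ z : X, ∑ σ ∈ Finset.univ.filter Q, if π (σ x) = π (σ z) then 1 else 0 := by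
        refine Finset.sum_congr rfl fun z _ => ?_
        rw [← Finset.card_filter, Finset.filter_filter]
        congr 1
        ext σ
        simp [and_comm]
    _ = ∑ σ ∈ Finset.univ.filter Q, ∑ z : X, if π (σ x) = π (σ z) then 1 else 0 :=
        Finset.sum_comm
    _ = ∑ σ ∈ Finset.univ.filter Q, d := by
        refine Finset.sum_congr rfl fun σ _ => ?_
        rw [Equiv.sum_comp σ (fun z => if π (σ x) = π z then 1 else 0), ← Finset.card_filter,
          ← hπ (π (σ x))]
        congr 1
        ext z
        simp [eq_comm]
    _ = _ := by simp [mul_comm]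

/-- The ordered pairs of distinct half-edges with the same end points. -/
def collisions {X V : Type*} [Fintype X] [DecidableEq X] [DecidableEq V] (ι : X → X)
    (ρ : X → V) : Finset (X × X) :=
  Finset.univ.filter fun p => p.1 ≠ p.2 ∧ ρ p.1 = ρ p.2 ∧ ρ (ι p.1) = ρ (ι p.2)

lemma mem_collisions {X V : Type*} [Fintype X] [DecidableEq X] [DecidableEq V] {ι : X → X}
    {ρ : X → V} {x y : X} :
    (x, y) ∈ collisions ι ρ ↔ x ≠ y ∧ ρ x = ρ y ∧ ρ (ι x) = ρ (ι y) := by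
  simp [collisions]

lemma sum_card_collisions_le {X V : Type*} [Fintype X] [DecidableEq X] [DecidableEq V] {d : ℕ}
    {ι : X → X} (hι : Function.Involutive ι) (hfix : ∀ x, ι x ≠ x) {π : X → V}
    (hπ : ∀ v, (Finset.univ.filter fun x => π x = v).card = d) (hX : 6 ≤ Fintype.card X) :
    ∑ σ : Equiv.Perm X, (collisions ι (π ∘ σ)).card
      ≤ (2 * d + 4 * d ^ 2) * Fintype.card (Equiv.Perm X) := by
  set N := Fintype.card X with hN
  set T := Fintype.card (Equiv.Perm X) with hT
  have hpair : ∀ x y, x ≠ y → N * (Finset.univ.filter fun σ : Equiv.Perm X =>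
      π (σ x) = π (σ y)).card ≤ 2 * d * T := by
    intro x y hxy
    have h := card_sdiff_mul_card_coincidence_le hπ x y {x} (by simp)
      (by simpa using hxy.symm) (fun _ => True) (by simp)
    simp only [and_true, Finset.filter_true, Finset.card_univ, Finset.card_singleton] at h
    rw [← hN, ← hT] at h
    calc N * _ ≤ (2 * (N - 1)) * (Finset.univ.filter fun σ : Equiv.Perm X =>
          π (σ x) = π (σ y)).card := Nat.mul_le_mul_right _ (by omega)
      _ ≤ _ := by rw [mul_assoc, mul_assoc]; exact Nat.mul_le_mul_left _ h
  have hquad : ∀ x y, x ≠ y → y ≠ ι x → N * (N * (Finset.univ.filter fun σ : Equiv.Perm X =>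
      π (σ x) = π (σ y) ∧ π (σ (ι x)) = π (σ (ι y))).card) ≤ 4 * d ^ 2 * T := by
    intro x y hxy hyx
    have hinj := hι.injective
    have h := card_sdiff_mul_card_coincidence_le hπ x y {x, ι x, ι y} (by simp)
      (by simp [hxy.symm, hyx, (hfix y).symm]) (fun σ => π (σ (ι x)) = π (σ (ι y))) (by
        intro σ z hz
        simp only [Finset.mem_insert, Finset.mem_singleton, not_or] at hz
        rw [Equiv.Perm.mul_apply, Equiv.Perm.mul_apply,
          Equiv.swap_apply_of_ne_of_ne (Ne.symm hyx) (Ne.symm hz.2.1),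
          Equiv.swap_apply_of_ne_of_ne (hfix y) (Ne.symm hz.2.2)])
    have h3 : ({x, ι x, ι y} : Finset X).card ≤ 3 := Finset.card_le_three
    rw [← hN] at h
    have h4 := hpair (ι x) (ι y) (fun h => hxy (hinj h))
    set a := (Finset.univ.filter fun σ : Equiv.Perm X =>
      π (σ x) = π (σ y) ∧ π (σ (ι x)) = π (σ (ι y))).card
    set b := (Finset.univ.filter fun σ : Equiv.Perm X => π (σ (ι x)) = π (σ (ι y))).card
    replace h : (N - ({x, ι x, ι y} : Finset X).card) * a ≤ d * b := by convert h
    have h5 : N * a ≤ 2 * d * b := by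
      calc N * a ≤ (2 * (N - ({x, ι x, ι y} : Finset X).card)) * a :=
            Nat.mul_le_mul_right _ (by omega)
        _ ≤ _ := by rw [mul_assoc, mul_assoc]; exact Nat.mul_le_mul_left _ h
    calc N * (N * a) ≤ N * (2 * d * b) := Nat.mul_le_mul_left _ h5
      _ = 2 * d * (N * b) := by ring
      _ ≤ 2 * d * (2 * d * T) := Nat.mul_le_mul_left _ h4
      _ = _ := by ring
  have hsum : ∑ σ : Equiv.Perm X, (collisions ι (π ∘ σ)).card
      = ∑ x, ∑ y, (Finset.univ.filter fun σ : Equiv.Perm X =>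
        x ≠ y ∧ π (σ x) = π (σ y) ∧ π (σ (ι x)) = π (σ (ι y))).card := by
    simp only [collisions, Finset.card_filter, Function.comp_apply]
    rw [Finset.sum_comm, Fintype.sum_prod_type]
  have hone : ∀ x, N * ∑ y, (Finset.univ.filter fun σ : Equiv.Perm X =>
        x ≠ y ∧ π (σ x) = π (σ y) ∧ π (σ (ι x)) = π (σ (ι y))).card
      ≤ (2 * d + 4 * d ^ 2) * T := by
    intro x
    set g : X → ℕ := fun y => (Finset.univ.filter fun σ : Equiv.Perm X =>
        x ≠ y ∧ π (σ x) = π (σ y) ∧ π (σ (ι x)) = π (σ (ι y))).card with hg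
    have hg1 : N * g (ι x) ≤ 2 * d * T := by
      refine le_trans (Nat.mul_le_mul_left _ (Finset.card_le_card ?_)) (hpair x (ι x) (hfix x).symm)
      intro σ hσ
      simp only [Finset.mem_filter, Finset.mem_univ, true_and] at hσ ⊢
      exact hσ.2.1
    have hg2 : ∀ y ∈ Finset.univ.erase (ι x), N * (N * g y) ≤ 4 * d ^ 2 * T := by
      intro y hy
      rcases eq_or_ne x y with rfl | hxy
      · simp [hg]
      · have := hquad x y hxy (Finset.ne_of_mem_erase hy)
        simpa [hg, hxy] using this
    have hg3 : N * (N * ∑ y ∈ Finset.univ.erase (ι x), g y) ≤ N * (4 * d ^ 2 * T) := by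
      rw [Finset.mul_sum, Finset.mul_sum]
      calc ∑ y ∈ Finset.univ.erase (ι x), N * (N * g y)
          ≤ (Finset.univ.erase (ι x)).card • (4 * d ^ 2 * T) := Finset.sum_le_card_nsmul _ _ _ hg2
        _ ≤ N * (4 * d ^ 2 * T) := by
          rw [smul_eq_mul]
          exact Nat.mul_le_mul_right _ (Finset.card_le_univ _)
    have hg4 := Nat.le_of_mul_le_mul_left hg3 (by omega)
    rw [← Finset.add_sum_erase _ g (Finset.mem_univ (ι x)), mul_add, add_mul]
    exact Nat.add_le_add hg1 hg4
  rw [hsum]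
  refine Nat.le_of_mul_le_mul_left (c := N) ?_ (by omega)
  rw [Finset.mul_sum]
  calc ∑ x, N * _ ≤ (Finset.univ : Finset X).card • ((2 * d + 4 * d ^ 2) * T) :=
        Finset.sum_le_card_nsmul _ _ _ fun x _ => hone x
    _ = _ := by rw [smul_eq_mul, Finset.card_univ]

lemma card_filter_comp_le {X V W : Type*} [Fintype X] [DecidableEq W] [DecidableEq V] {d : ℕ}
    {ρ : X → V} (hρ : ∀ v, (Finset.univ.filter fun x => ρ x = v).card = d) (φ : X → X)
    (hφ : Function.Injective φ) (s : Finset W) (g : W → V) :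
    (Finset.univ.filter fun z => ∃ q ∈ s, ρ (φ z) = g q).card ≤ s.card * d := by
  have h : (Finset.univ.filter fun z => ∃ q ∈ s, ρ (φ z) = g q)
      ⊆ s.biUnion fun q => Finset.univ.filter fun z => ρ (φ z) = g q := by
    intro z hz
    simpa using hz
  refine (Finset.card_le_card h).trans (Finset.card_biUnion_le_card_mul _ _ _ fun q _ => ?_)
  rw [← hρ (g q)]
  exact Finset.card_le_card_of_injOn φ (by intro z hz; simpa using hz) hφ.injOn

lemma exists_swap_collisions_ssubset {X V : Type*} [Fintype X] [DecidableEq X] [DecidableEq V]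
    {d : ℕ} {ι : X → X} (hι : Function.Involutive ι) (hfix : ∀ x, ι x ≠ x) {ρ : X → V}
    (hρ : ∀ v, (Finset.univ.filter fun x => ρ x = v).card = d)
    (hN : 2 + 3 * d + 2 * d ^ 2 + (collisions ι ρ).card < Fintype.card X)
    (hne : (collisions ι ρ).Nonempty) :
    ∃ x z, collisions ι (ρ ∘ Equiv.swap x z) ⊂ collisions ι ρ := by
  obtain ⟨⟨x, y⟩, hxy⟩ := hne
  have hinj := hι.injective
  set u := ρ (ι x) with hu
  set v := ρ x with hv
  obtain ⟨z, hz⟩ : ∃ z, z ∉ ({x, ι x} : Finset X)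
      ∪ (Finset.univ.filter fun z => ∃ q ∈ Finset.univ.filter fun q => ρ q = u,
          ρ (id z) = ρ (ι q))
      ∪ (Finset.univ.filter fun z => ∃ q ∈ ({u} : Finset V), ρ (id z) = id q)
      ∪ (Finset.univ.filter fun z => ∃ q ∈ ({v} : Finset V), ρ (id z) = id q)
      ∪ (Finset.univ.filter fun z => ∃ q ∈ Finset.univ.filter fun q => ρ q = v,
          ρ (ι z) = ρ (ι q))
      ∪ (Finset.univ.filter fun z => ∃ q ∈ ({v} : Finset V), ρ (ι z) = id q)
      ∪ (collisions ι ρ).image Prod.fst := by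
    by_contra! hcon
    have hcard := Finset.card_le_card (s := Finset.univ) (fun z _ => hcon z)
    rw [Finset.card_univ] at hcard
    have h1 : ({x, ι x} : Finset X).card ≤ 2 := Finset.card_le_two
    have h2 := card_filter_comp_le hρ id Function.injective_id
      (Finset.univ.filter fun q => ρ q = u) (fun q => ρ (ι q))
    have h3 := card_filter_comp_le hρ id Function.injective_id ({u} : Finset V) id
    have h4 := card_filter_comp_le hρ id Function.injective_id ({v} : Finset V) id
    have h5 := card_filter_comp_le hρ ι hinj
      (Finset.univ.filter fun q => ρ q = v) (fun q => ρ (ι q))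
    have h6 := card_filter_comp_le hρ ι hinj ({v} : Finset V) id
    have h7 : ((collisions ι ρ).image Prod.fst).card ≤ _ := Finset.card_image_le
    rw [hρ] at h2 h5
    rw [Finset.card_singleton] at h3 h4 h6
    have h8 := hcard.trans <| (Finset.card_union_le _ _).trans <| Nat.add_le_add
      ((Finset.card_union_le _ _).trans <| Nat.add_le_add
      ((Finset.card_union_le _ _).trans <| Nat.add_le_add
      ((Finset.card_union_le _ _).trans <| Nat.add_le_add
      ((Finset.card_union_le _ _).trans <| Nat.add_le_add
      ((Finset.card_union_le _ _).trans <| Nat.add_le_add h1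
      (show _ ≤ d * d by convert h2)) h3) h4)
      (show _ ≤ d * d by convert h5)) h6) h7
    nlinarith
  simp only [Finset.mem_union, Finset.mem_insert, Finset.mem_singleton, Finset.mem_filter,
    Finset.mem_univ, true_and, not_or, id, exists_eq_left, not_exists, not_and,
    Finset.mem_image, Prod.exists, exists_and_right, exists_eq_right] at hz
  obtain ⟨⟨⟨⟨⟨⟨⟨hzx, hzx'⟩, hF2⟩, hF3⟩, hF4⟩, hF5⟩, hF6⟩, hF7⟩ := hz
  have hzl : ρ z ≠ ρ (ι z) := fun h =>
    hF7 (ι z) (mem_collisions.2 ⟨(hfix z).symm, h, by rw [hι]; exact h.symm⟩)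
  have hxz' : ι z ≠ x := fun h => hzx' (by rw [← h, hι])
  have hιzx : ι z ≠ ι x := fun h => hzx (hinj h)
  set ρ' := ρ ∘ Equiv.swap x z with hρ'
  have e1 : ρ' x = ρ z := by simp [hρ']
  have e2 : ρ' z = v := by simp [hρ', hv]
  have e3 : ∀ q, q ≠ x → q ≠ z → ρ' q = ρ q := fun q h1 h2 => by
    simp [hρ', Equiv.swap_apply_of_ne_of_ne h1 h2]
  have e4 : ρ' (ι x) = u := e3 _ (hfix x) (Ne.symm hzx')
  have e5 : ρ' (ι z) = ρ (ι z) := e3 _ hxz' (hfix z)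
  have e6 : ∀ q, q ≠ ι x → q ≠ ι z → ρ' (ι q) = ρ (ι q) := fun q h1 h2 =>
    e3 _ (fun h => h1 (by rw [← h, hι])) (fun h => h2 (by rw [← h, hι]))
  have hx0 : ∀ q, (x, q) ∉ collisions ι ρ' := by
    intro q hq
    obtain ⟨h1, h2, h3⟩ := mem_collisions.1 hq
    rw [e1] at h2
    rw [e4] at h3
    by_cases hq1 : q = z
    · subst hq1; exact hF4 (h2.trans e2)
    by_cases hq2 : q = ι x
    · subst hq2; exact hF3 (h2.trans e4)
    by_cases hq3 : q = ι z
    · subst hq3; exact hzl (h2.trans e5)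
    rw [e3 q (Ne.symm h1) hq1] at h2
    rw [e6 q hq2 hq3] at h3
    exact hF2 (ι q) h3.symm (by rw [hι, h2])
  have hz0 : ∀ q, (z, q) ∉ collisions ι ρ' := by
    intro q hq
    obtain ⟨h1, h2, h3⟩ := mem_collisions.1 hq
    rw [e2] at h2
    rw [e5] at h3
    by_cases hq1 : q = x
    · subst hq1; exact hF4 (e1.symm.trans h2.symm)
    by_cases hq2 : q = ι x
    · subst hq2
      rw [hι, e1] at h3
      exact hzl h3.symm
    by_cases hq3 : q = ι z
    · subst hq3; exact hF6 (e5.symm.trans h2.symm)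
    rw [e3 q hq1 (Ne.symm h1)] at h2
    rw [e6 q hq2 hq3] at h3
    exact hF5 q h2.symm h3
  have hsymm : ∀ p q, (p, q) ∈ collisions ι ρ' → (q, p) ∈ collisions ι ρ' := by
    intro p q h
    rw [mem_collisions] at h ⊢
    exact ⟨h.1.symm, h.2.1.symm, h.2.2.symm⟩
  have hinv : ∀ p q, (p, q) ∈ collisions ι ρ' → (ι p, ι q) ∈ collisions ι ρ' := by
    intro p q h
    rw [mem_collisions] at h ⊢
    rw [hι, hι]
    exact ⟨fun h' => h.1 (hinj h'), h.2.2, h.2.1⟩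
  have havoid : ∀ p q, (p, q) ∈ collisions ι ρ' → p ≠ x ∧ p ≠ z ∧ p ≠ ι x ∧ p ≠ ι z := by
    intro p q h
    refine ⟨?_, ?_, ?_, ?_⟩
    · rintro rfl; exact hx0 _ h
    · rintro rfl; exact hz0 _ h
    · rintro rfl
      have := hinv _ _ h
      rw [hι] at this
      exact hx0 _ this
    · rintro rfl
      have := hinv _ _ h
      rw [hι] at this
      exact hz0 _ this
  refine ⟨x, z, Finset.ssubset_iff_subset_ne.2 ⟨?_, fun h => hx0 y (h ▸ hxy)⟩⟩
  rintro ⟨p, q⟩ h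
  change (p, q) ∈ collisions ι ρ' at h
  obtain ⟨p1, p2, p3, p4⟩ := havoid p q h
  obtain ⟨q1, q2, q3, q4⟩ := havoid q p (hsymm _ _ h)
  rw [mem_collisions] at h ⊢
  rw [e3 p p1 p2, e3 q q1 q2, e6 p p3 p4, e6 q q3 q4] at h
  exact h

lemma card_filter_collisions_le {X V : Type*} [Fintype X] [DecidableEq X] [DecidableEq V]
    {d : ℕ} {ι : X → X} (hι : Function.Involutive ι) (hfix : ∀ x, ι x ≠ x) {π : X → V}
    (hπ : ∀ v, (Finset.univ.filter fun x => π x = v).card = d) (k : ℕ)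
    (hN : 2 + 3 * d + 2 * d ^ 2 + k < Fintype.card X) :
    (Finset.univ.filter fun σ : Equiv.Perm X => (collisions ι (π ∘ σ)).card ≤ k).card
      ≤ (1 + Fintype.card X ^ 2) ^ k *
        (Finset.univ.filter fun σ : Equiv.Perm X => collisions ι (π ∘ σ) = ∅).card := by
  induction k with
  | zero => simp
  | succ k ih =>
    set F := Finset.univ.filter fun σ : Equiv.Perm X => (collisions ι (π ∘ σ)).card ≤ k with hF
    have hsub : (Finset.univ.filter fun σ : Equiv.Perm X =>
        (collisions ι (π ∘ σ)).card ≤ k + 1)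
        ⊆ F ∪ (Finset.univ ×ˢ F).image fun p : (X × X) × Equiv.Perm X =>
          p.2 * Equiv.swap p.1.1 p.1.2 := by
      intro σ hσ
      simp only [Finset.mem_filter, Finset.mem_univ, true_and] at hσ
      rw [Finset.mem_union]
      rcases (collisions ι (π ∘ σ)).eq_empty_or_nonempty with he | hne
      · left
        simp [hF, he]
      · right
        have hfib : ∀ v, (Finset.univ.filter fun x => (π ∘ σ) x = v).card = d := by
          intro v
          rw [← hπ v]
          refine Finset.card_bij (fun x _ => σ x) (by simp) (by simp)
            fun y hy => ⟨σ.symm y, ?_, ?_⟩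
          · simpa using hy
          · simp
        obtain ⟨x, z, hxz⟩ := exists_swap_collisions_ssubset hι hfix hfib (by omega) hne
        rw [Finset.mem_image]
        refine ⟨((x, z), σ * Equiv.swap x z), ?_, by simp [mul_assoc]⟩
        simp only [Finset.mem_product, Finset.mem_univ, true_and, hF, Finset.mem_filter]
        have := Finset.card_lt_card hxz
        have h2 : π ∘ ⇑(σ * Equiv.swap x z) = (π ∘ σ) ∘ Equiv.swap x z := rfl
        rw [h2]
        omega
    have h1 := Finset.card_le_card hsub
    have h2 : ((Finset.univ ×ˢ F).image fun p : (X × X) × Equiv.Perm X =>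
          p.2 * Equiv.swap p.1.1 p.1.2).card ≤ Fintype.card X ^ 2 * F.card := by
      refine Finset.card_image_le.trans ?_
      rw [Finset.card_product, Finset.card_univ, Fintype.card_prod, pow_two]
    calc _ ≤ F.card + Fintype.card X ^ 2 * F.card :=
          h1.trans ((Finset.card_union_le _ _).trans (Nat.add_le_add_left h2 _))
      _ = (1 + Fintype.card X ^ 2) * F.card := by ring
      _ ≤ (1 + Fintype.card X ^ 2) * ((1 + Fintype.card X ^ 2) ^ k * _) :=
          Nat.mul_le_mul_left _ (ih (by omega))
      _ = _ := by rw [pow_succ]; ring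

/-- The configuration model is simple with at least inverse polynomial probability. -/
lemma card_perm_le_mul_card_simple {X V : Type*} [Fintype X] [DecidableEq X] [DecidableEq V]
    {d : ℕ} {ι : X → X} (hι : Function.Involutive ι) (hfix : ∀ x, ι x ≠ x) {π : X → V}
    (hπ : ∀ v, (Finset.univ.filter fun x => π x = v).card = d)
    (hN : 6 + 7 * d + 10 * d ^ 2 < Fintype.card X) :
    Fintype.card (Equiv.Perm X) ≤ 2 * (1 + Fintype.card X ^ 2) ^ (4 * d + 8 * d ^ 2) *
        (Finset.univ.filter fun σ : Equiv.Perm X => collisions ι (π ∘ σ) = ∅).card := by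
  set K := 4 * d + 8 * d ^ 2 with hK
  have h1 := sum_card_collisions_le hι hfix hπ (by omega)
  have h2 := card_filter_collisions_le hι hfix hπ K (by omega)
  set T := Fintype.card (Equiv.Perm X) with hT
  set P := Finset.univ.filter fun σ : Equiv.Perm X => (collisions ι (π ∘ σ)).card ≤ K
  set Q := Finset.univ.filter fun σ : Equiv.Perm X => ¬ (collisions ι (π ∘ σ)).card ≤ K
  have h3 : P.card + Q.card = T := by
    rw [hT, ← Finset.card_univ]
    exact Finset.card_filter_add_card_filter_not _
  have h4 : Q.card * (K + 1) ≤ (2 * d + 4 * d ^ 2) * T := by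
    calc Q.card * (K + 1) = ∑ σ ∈ Q, (K + 1) := by simp
      _ ≤ ∑ σ ∈ Q, (collisions ι (π ∘ σ)).card := by
        refine Finset.sum_le_sum fun σ hσ => ?_
        simp only [Q, Finset.mem_filter, Finset.mem_univ, true_and] at hσ
        omega
      _ ≤ ∑ σ : Equiv.Perm X, (collisions ι (π ∘ σ)).card :=
        Finset.sum_le_sum_of_subset (Finset.subset_univ _)
      _ ≤ _ := h1
  have h5 : T ≤ 2 * P.card := by
    have : 2 * Q.card * (K + 1) ≤ T * (K + 1) := by
      calc 2 * Q.card * (K + 1) ≤ 2 * ((2 * d + 4 * d ^ 2) * T) := by nlinarith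
        _ = K * T := by rw [hK]; ring
        _ ≤ _ := by nlinarith
    have := Nat.le_of_mul_le_mul_right this (by omega)
    omega
  calc T ≤ 2 * P.card := h5
    _ ≤ 2 * _ := Nat.mul_le_mul_left _ h2
    _ = _ := by ring

/-- The vertices whose neighborhoods in two graphs differ. -/
def diffVerts {n : ℕ} (G G' : SimpleGraph (Fin n)) : Finset (Fin n) :=
  Finset.univ.filter fun v => G.neighborSet v ≠ G'.neighborSet v

lemma card_diffVerts_pairGraph_le {X : Type*} [Fintype X] [DecidableEq X] {n : ℕ} {ι : X → X}
    (hι : Function.Involutive ι) (π : X → Fin n) (σ τ : Equiv.Perm X) :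
    (diffVerts (pairGraph ι hι (π ∘ σ)) (pairGraph ι hι (π ∘ τ))).card ≤ 4 * permHam σ τ := by
  set F := Finset.univ.filter fun x => σ x ≠ τ x with hF
  have hsub : diffVerts (pairGraph ι hι (π ∘ σ)) (pairGraph ι hι (π ∘ τ))
      ⊆ (F ∪ F.image ι).image (π ∘ σ) ∪ (F ∪ F.image ι).image (π ∘ τ) := by
    intro v hv
    by_contra hcon
    simp only [Finset.mem_union, not_or] at hcon
    simp only [diffVerts, Finset.mem_filter, Finset.mem_univ, true_and] at hv
    apply hv
    have key : ∀ x, x ∉ F ∪ F.image ι → σ x = τ x ∧ σ (ι x) = τ (ι x) := by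
      intro x hx
      simp only [Finset.mem_union, not_or, hF, Finset.mem_filter, Finset.mem_univ, true_and,
        not_not, Finset.mem_image, not_exists, not_and] at hx
      refine ⟨hx.1, ?_⟩
      by_contra h
      exact hx.2 _ h (hι x)
    ext w
    constructor
    · rintro ⟨hne, x, h1, h2⟩
      have hx : x ∉ F ∪ F.image ι := fun h => hcon.1 (Finset.mem_image.2 ⟨x, h, h1⟩)
      obtain ⟨k1, k2⟩ := key x hx
      exact ⟨hne, x, by simpa [← k1] using h1, by simpa [← k2] using h2⟩
    · rintro ⟨hne, x, h1, h2⟩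
      have hx : x ∉ F ∪ F.image ι := fun h => hcon.2 (Finset.mem_image.2 ⟨x, h, h1⟩)
      obtain ⟨k1, k2⟩ := key x hx
      exact ⟨hne, x, by simpa [k1] using h1, by simpa [k2] using h2⟩
  have hD : (F ∪ F.image ι).card ≤ 2 * F.card :=
    (Finset.card_union_le _ _).trans (by have := Finset.card_image_le (s := F) (f := ι); omega)
  have hFc : F.card = permHam σ τ := by
    rw [hF, permHam]
  have h1 := (Finset.card_le_card hsub).trans (Finset.card_union_le _ _)
  have h2 : ((F ∪ F.image ι).image (π ∘ σ)).card ≤ _ := Finset.card_image_le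
  have h3 : ((F ∪ F.image ι).image (π ∘ τ)).card ≤ _ := Finset.card_image_le
  omega

lemma card_filter_comp_perm {X V : Type*} [Fintype X] [DecidableEq V] {d : ℕ} {π : X → V}
    (hπ : ∀ v, (Finset.univ.filter fun x => π x = v).card = d) (σ : Equiv.Perm X) (v : V) :
    (Finset.univ.filter fun x => (π ∘ σ) x = v).card = d := by
  rw [← hπ v]
  refine Finset.card_bij (fun x _ => σ x) (by simp) (by simp)
    fun y hy => ⟨σ.symm y, ?_, ?_⟩
  · simpa using hy
  · simp

lemma exists_card_filter_pairGraph_mem_eq {X : Type*} [Fintype X] [DecidableEq X] [Nonempty X]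
    {n d : ℕ} {ι : X → X} (hι : Function.Involutive ι) (hfix : ∀ x, ι x ≠ x) {π : X → Fin n}
    (hπ : ∀ v, (Finset.univ.filter fun x => π x = v).card = d) :
    ∃ c : ℕ, ∀ S ⊆ regularGraphs d n,
      (Finset.univ.filter fun σ : Equiv.Perm X => pairGraph ι hι (π ∘ σ) ∈ S).card
        = c * S.ncard := by
  refine ⟨((Finset.univ.filter fun k : Equiv.Perm X => ∀ x, π (k x) = π x) ×ˢ
    (Finset.univ.filter fun c : Equiv.Perm X => ∀ x, c (ι x) = ι (c x))).card, fun S hS => ?_⟩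
  rw [Set.ncard_eq_toFinset_card', mul_comm, ← smul_eq_mul, ← Finset.sum_const,
    Finset.card_eq_sum_card_fiberwise (f := fun σ : Equiv.Perm X => pairGraph ι hι (π ∘ σ))
      (t := S.toFinset) (by intro σ hσ; simpa using hσ)]
  refine Finset.sum_congr rfl fun G hG => ?_
  rw [Set.mem_toFinset] at hG
  obtain ⟨σ₁, rfl⟩ := exists_pairGraph_eq hι hfix hπ (hS hG)
  rw [← card_pairGraph_eq hι hfix hπ σ₁ (hS hG), Finset.filter_filter]
  congr 1
  ext σ
  simp only [Finset.mem_filter, Finset.mem_univ, true_and, and_iff_right_iff_imp]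
  intro h
  rwa [h]

lemma collisions_eq_empty_imp_regular {X : Type*} [Fintype X] [DecidableEq X] {n d : ℕ}
    {ι : X → X} (hι : Function.Involutive ι) (hfix : ∀ x, ι x ≠ x) {ρ : X → Fin n}
    (hρ : ∀ v, (Finset.univ.filter fun x => ρ x = v).card = d) (h : collisions ι ρ = ∅) :
    pairGraph ι hι ρ ∈ regularGraphs d n := by
  refine regular_of_dart_injective hι hfix hρ fun x y hxy => ?_
  by_contra hne
  simp only [Prod.mk.injEq] at hxy
  have : (x, y) ∈ collisions ι ρ := mem_collisions.2 ⟨hne, hxy.1, hxy.2⟩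
  simp [h] at this

lemma ncard_mul_ncard_le_of_diffVerts {d n : ℕ} (hn : Even (n * d))
    (hN : 6 + 7 * d + 10 * d ^ 2 < n * d) {A B : Set (SimpleGraph (Fin n))}
    (hA : A ⊆ regularGraphs d n) (hB : B ⊆ regularGraphs d n) {t : ℝ} (ht : 0 ≤ t)
    (hAB : ∀ G ∈ B, ∀ G' ∈ A, t ≤ (diffVerts G G').card) :
    (A.ncard : ℝ) * B.ncard ≤ 4 * (1 + ((n * d : ℕ) : ℝ) ^ 2) ^ (8 * d + 16 * d ^ 2)
      * Real.exp (-(t ^ 2 / (512 * (n * d : ℕ)))) * (regularGraphs d n).ncard ^ 2 := by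
  set N := n * d with hNd
  let ι : Fin N → Fin N := Fin.rev
  have hι : Function.Involutive ι := Fin.rev_involutive
  have hfix : ∀ x, ι x ≠ x := by
    intro x hx
    have h1 : (Fin.rev x).val = x.val := congrArg Fin.val hx
    rw [Fin.val_rev] at h1
    obtain ⟨k, hk⟩ := hn
    have := x.2
    omega
  let π : Fin N → Fin n := fun x => (finProdFinEquiv.symm x).1
  have hπ : ∀ v, (Finset.univ.filter fun x => π x = v).card = d := by
    intro v
    have : (Finset.univ.filter fun x => π x = v)
        = (Finset.univ : Finset (Fin d)).map
          ⟨fun j => finProdFinEquiv (v, j), fun a b h => by simpa using h⟩ := by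
      ext x
      simp only [Finset.mem_filter, Finset.mem_univ, true_and, Finset.mem_map, π]
      constructor
      · rintro rfl
        exact ⟨(finProdFinEquiv.symm x).2, finProdFinEquiv.apply_symm_apply x⟩
      · rintro ⟨j, rfl⟩
        exact congrArg Prod.fst (finProdFinEquiv.symm_apply_apply (v, j))
    rw [this]
    simp
  have : Nonempty (Fin N) := ⟨⟨0, by omega⟩⟩
  obtain ⟨c, hc⟩ := exists_card_filter_pairGraph_mem_eq hι hfix hπ
  have hsimple := card_perm_le_mul_card_simple hι hfix hπ (by simpa using hN)
  set R := (regularGraphs d n).ncard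
  have hcR : (N.factorial : ℝ) ≤ 2 * (1 + (N : ℝ) ^ 2) ^ (4 * d + 8 * d ^ 2) * (c * R) := by
    have h1 : (Finset.univ.filter fun σ : Equiv.Perm (Fin N) => collisions ι (π ∘ σ) = ∅).card
        ≤ c * R := by
      rw [← hc _ subset_rfl]
      refine Finset.card_le_card fun σ hσ => ?_
      simp only [Finset.mem_filter, Finset.mem_univ, true_and] at hσ ⊢
      exact collisions_eq_empty_imp_regular hι hfix (card_filter_comp_perm hπ σ) hσ
    rw [Fintype.card_perm, Fintype.card_fin] at hsimple
    exact_mod_cast hsimple.trans (Nat.mul_le_mul_left _ h1)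
  have hperm := card_mul_card_le_of_permHam
    (Finset.univ.filter fun σ : Equiv.Perm (Fin N) => pairGraph ι hι (π ∘ σ) ∈ A)
    (Finset.univ.filter fun σ : Equiv.Perm (Fin N) => pairGraph ι hι (π ∘ σ) ∈ B) (t / 4)
    (by positivity) (by
      intro σ hσ τ hτ
      simp only [Finset.mem_filter, Finset.mem_univ, true_and] at hσ hτ
      have h1 := hAB _ hσ _ hτ
      have h2 : ((diffVerts (pairGraph ι hι (π ∘ σ)) (pairGraph ι hι (π ∘ τ))).card : ℝ)
          ≤ 4 * permHam σ τ := by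
        exact_mod_cast card_diffVerts_pairGraph_le hι π σ τ
      linarith)
  rw [hc A hA, hc B hB] at hperm
  have hcpos : (0 : ℝ) < c := by
    rcases Nat.eq_zero_or_pos c with h | h
    · have := N.factorial_pos
      rw [h] at hcR
      simp at hcR
      have h2 : (0 : ℝ) < N.factorial := by exact_mod_cast this
      linarith
    · exact_mod_cast h
  have e1 : (t / 4) ^ 2 / (32 * (N : ℝ)) = t ^ 2 / (512 * (N : ℝ)) := by
    rw [div_pow, div_div]
    congr 1
    ring
  rw [e1] at hperm
  set E := Real.exp (-(t ^ 2 / (512 * (N : ℝ))))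
  have hE : 0 ≤ E := (Real.exp_pos _).le
  have hsq : (N.factorial : ℝ) ^ 2
      ≤ (2 * (1 + (N : ℝ) ^ 2) ^ (4 * d + 8 * d ^ 2) * (c * R)) ^ 2 :=
    pow_le_pow_left₀ (by positivity) hcR 2
  have e2 : (2 * (1 + (N : ℝ) ^ 2) ^ (4 * d + 8 * d ^ 2) * (c * R)) ^ 2
      = c ^ 2 * (4 * (1 + (N : ℝ) ^ 2) ^ (8 * d + 16 * d ^ 2) * R ^ 2) := by
    rw [show 8 * d + 16 * d ^ 2 = (4 * d + 8 * d ^ 2) * 2 by ring, pow_mul]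
    ring
  rw [e2] at hsq
  have hfin := hperm.trans (mul_le_mul_of_nonneg_right hsq hE)
  push_cast at hfin
  have : (c : ℝ) ^ 2 * ((A.ncard : ℝ) * B.ncard)
      ≤ c ^ 2 * (4 * (1 + (N : ℝ) ^ 2) ^ (8 * d + 16 * d ^ 2) * E * R ^ 2) := by
    linarith
  exact le_of_mul_le_mul_left this (by positivity)

lemma tendsto_poly_mul_exp (d K : ℕ) (hd : 0 < d) {η : ℝ} (hη : 0 < η) :
    Tendsto (fun n : ℕ => 8 * (1 + ((n * d : ℕ) : ℝ) ^ 2) ^ K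
      * Real.exp (-((η * n) ^ 2 / (512 * (n * d : ℕ))))) atTop (𝓝 0) := by
  set c := η ^ 2 / (512 * d) with hc
  have hcpos : 0 < c := by positivity
  have h1 : Tendsto (fun x : ℝ => x ^ (2 * K) * Real.exp (-c * x)) atTop (𝓝 0) := by
    have := (Real.tendsto_pow_mul_exp_neg_atTop_nhds_zero (2 * K)).comp
      (tendsto_id.const_mul_atTop hcpos)
    have h2 := this.const_mul ((c ^ (2 * K))⁻¹)
    rw [mul_zero] at h2
    refine h2.congr fun x => ?_
    simp only [Function.comp, id, mul_pow]
    field_simp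
  have h2 := (h1.comp tendsto_natCast_atTop_atTop).const_mul (8 * (2 * (d : ℝ) ^ 2) ^ K)
  rw [mul_zero] at h2
  refine squeeze_zero' (Eventually.of_forall fun n => by positivity) ?_ h2
  filter_upwards [eventually_ge_atTop 1] with n hn
  have hn' : (1 : ℝ) ≤ n := by exact_mod_cast hn
  have hd' : (1 : ℝ) ≤ d := by exact_mod_cast hd
  have e1 : (η * n) ^ 2 / (512 * ((n * d : ℕ) : ℝ)) = c * n := by
    rw [hc]; push_cast; field_simp
  have e2 : (1 + ((n * d : ℕ) : ℝ) ^ 2) ^ K ≤ (2 * (d : ℝ) ^ 2) ^ K * (n : ℝ) ^ (2 * K) := by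
    rw [pow_mul, ← mul_pow]
    refine pow_le_pow_left₀ (by positivity) ?_ K
    push_cast
    have : (1 : ℝ) ≤ n * d := by nlinarith
    nlinarith
  rw [e1]
  simp only [Function.comp]
  rw [← neg_mul]
  have hE := (Real.exp_pos (-c * n)).le
  nlinarith [mul_le_mul_of_nonneg_right e2 hE]

/-- Measure concentration for the uniform random regular graph: most regular graphs are close
to any given set of at least half of the regular graphs. -/
lemma eventually_le_PrG_diffVerts {d : ℕ} (hd : 0 < d) {η δ : ℝ} (hη : 0 < η) (hδ : 0 < δ) :
    ∀ᶠ n in goodFilter d, ∀ A : Set (SimpleGraph (Fin n)), 1 / 2 ≤ PrG d n A →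
      1 - δ ≤ PrG d n {G | ∃ G' ∈ regularGraphs d n ∩ A, ((diffVerts G G').card : ℝ) ≤ η * n} := by
  rw [goodFilter, eventually_inf_principal]
  filter_upwards [eventually_gt_atTop (6 + 7 * d + 10 * d ^ 2),
    (tendsto_poly_mul_exp d (8 * d + 16 * d ^ 2) hd hη).eventually (gt_mem_nhds hδ)]
    with n hn hsmall hgood A hA
  set R := regularGraphs d n with hR
  set T := {G | ∃ G' ∈ R ∩ A, ((diffVerts G G').card : ℝ) ≤ η * n} with hT
  have hRpos : (0 : ℝ) < R.ncard := by
    rcases Nat.eq_zero_or_pos R.ncard with h | h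
    · rw [PrG, ← hR, h] at hA
      norm_num at hA
    · exact_mod_cast h
  rw [PrG, le_div_iff₀ hRpos] at hA ⊢
  have hsplit : ((R ∩ T).ncard : ℝ) + (R \ T).ncard = R.ncard := by
    exact_mod_cast Set.ncard_inter_add_ncard_sdiff_eq_ncard R T
  have h := ncard_mul_ncard_le_of_diffVerts hgood.2 (by nlinarith) (A := R ∩ A) (B := R \ T)
    Set.inter_subset_left Set.sdiff_subset (t := η * n) (by positivity) (by
      intro G hG G' hG'
      by_contra! hlt
      exact hG.2 ⟨G', hG', hlt.le⟩)
  set E := (1 + ((n * d : ℕ) : ℝ) ^ 2) ^ (8 * d + 16 * d ^ 2)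
      * Real.exp (-((η * n) ^ 2 / (512 * (n * d : ℕ)))) with hE
  have h1 : 1 / 2 * (R.ncard : ℝ) * (R \ T).ncard ≤ 4 * E * R.ncard ^ 2 := by
    refine (mul_le_mul_of_nonneg_right hA (by positivity)).trans (h.trans (le_of_eq ?_))
    rw [hE]; ring
  have h2 : (R.ncard : ℝ) * (R \ T).ncard ≤ R.ncard * (8 * E * R.ncard) := by nlinarith
  have h3 := le_of_mul_le_mul_left h2 hRpos
  have h4 : 8 * E < δ := by rw [hE]; linarith
  nlinarith

lemma exists_walk_length_succ {V : Type*} {G : SimpleGraph V} {v w : V} {k : ℕ} :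
    (∃ p : G.Walk v w, p.length = k + 1) ↔
      ∃ u, (∃ p : G.Walk v u, p.length = k) ∧ G.Adj u w := by
  constructor
  · rintro ⟨p, hp⟩
    have hnil : ¬ p.reverse.Nil := by
      intro h
      have := SimpleGraph.Walk.length_eq_zero_iff.2 h
      simp [hp] at this
    obtain ⟨u, hu, q, hq⟩ := SimpleGraph.Walk.not_nil_iff.1 hnil
    refine ⟨u, ⟨q.reverse, ?_⟩, hu.symm⟩
    have := congrArg SimpleGraph.Walk.length hq
    simp only [SimpleGraph.Walk.length_reverse, SimpleGraph.Walk.length_cons] at this ⊢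
    omega
  · rintro ⟨u, ⟨p, hp⟩, h⟩
    exact ⟨p.concat h, by simp [hp]⟩

lemma reachable_and_dist_eq_iff {V : Type*} {G : SimpleGraph V} {v w : V} {k : ℕ} :
    (G.Reachable v w ∧ G.dist v w = k) ↔
      (∃ p : G.Walk v w, p.length = k) ∧ ∀ j < k, ¬ ∃ p : G.Walk v w, p.length = j := by
  constructor
  · rintro ⟨h, rfl⟩
    refine ⟨h.exists_walk_length_eq_dist, ?_⟩
    rintro j hj ⟨p, rfl⟩
    exact absurd (SimpleGraph.dist_le p) (by omega)
  · rintro ⟨⟨p, rfl⟩, h⟩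
    refine ⟨p.reachable, (SimpleGraph.dist_le p).antisymm ?_⟩
    by_contra! hlt
    exact h _ hlt p.reachable.exists_walk_length_eq_dist

/-- The vertices of `D` are at distance more than `r` from `v`. -/
def FarFrom {n : ℕ} (G : SimpleGraph (Fin n)) (v : Fin n) (r : ℕ) (D : Finset (Fin n)) : Prop :=
  ∀ k ≤ r, ∀ w ∈ D, ¬ ∃ p : G.Walk v w, p.length = k

section Locality

variable {n : ℕ} {G G' : SimpleGraph (Fin n)} {v : Fin n} {r : ℕ}

lemma FarFrom.adj_iff (h : FarFrom G v r (diffVerts G G')) {k : ℕ} (hk : k ≤ r) {u : Fin n}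
    (hu : ∃ p : G.Walk v u, p.length = k) (w : Fin n) : G.Adj u w ↔ G'.Adj u w := by
  have : u ∉ diffVerts G G' := fun hmem => h k hk u hmem hu
  simp only [diffVerts, Finset.mem_filter, Finset.mem_univ, true_and, not_not] at this
  exact Set.ext_iff.1 this w

lemma FarFrom.exists_walk_iff (h : FarFrom G v r (diffVerts G G')) {k : ℕ} (hk : k ≤ r + 1)
    (w : Fin n) : (∃ p : G.Walk v w, p.length = k) ↔ ∃ p : G'.Walk v w, p.length = k := by
  induction k generalizing w with
  | zero =>
    constructor
    · rintro ⟨p, hp⟩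
      obtain rfl := SimpleGraph.Walk.eq_of_length_eq_zero hp
      exact ⟨.nil, rfl⟩
    · rintro ⟨p, hp⟩
      obtain rfl := SimpleGraph.Walk.eq_of_length_eq_zero hp
      exact ⟨.nil, rfl⟩
  | succ k ih =>
    rw [exists_walk_length_succ, exists_walk_length_succ]
    refine exists_congr fun u => ?_
    rw [← ih (by omega)]
    exact and_congr_right fun hu => h.adj_iff (by omega) hu w

lemma FarFrom.dist_iff (h : FarFrom G v r (diffVerts G G')) {k : ℕ} (hk : k ≤ r + 1)
    (w : Fin n) : (G.Reachable v w ∧ G.dist v w = k) ↔ (G'.Reachable v w ∧ G'.dist v w = k) := by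
  rw [reachable_and_dist_eq_iff, reachable_and_dist_eq_iff, h.exists_walk_iff hk]
  refine and_congr_right fun _ => forall₂_congr fun j hj => ?_
  rw [h.exists_walk_iff (by omega)]

lemma exists_walk_of_mem_bfsLayer {σ : Equiv.Perm (Fin n)} {k : ℕ} {u : Fin n}
    (hu : u ∈ bfsLayer G v σ k) : ∃ p : G.Walk v u, p.length = k := by
  cases k with
  | zero =>
    simp only [bfsLayer, List.mem_singleton] at hu
    subst hu
    exact ⟨.nil, rfl⟩
  | succ k =>
    simp only [bfsLayer, List.mem_mergeSort, List.mem_filter, decide_eq_true_eq] at hu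
    exact (reachable_and_dist_eq_iff.1 hu.2).1

lemma FarFrom.find?_eq (h : FarFrom G v r (diffVerts G G')) {σ : Equiv.Perm (Fin n)} {k : ℕ}
    (hk : k ≤ r) (w : Fin n) :
    (bfsLayer G v σ k).find? (fun u => decide (G.Adj u w))
      = (bfsLayer G v σ k).find? (fun u => decide (G'.Adj u w)) :=
  List.find?_congr fun u hu => by
    rw [decide_eq_decide]
    exact h.adj_iff hk (exists_walk_of_mem_bfsLayer hu) w

lemma FarFrom.bfsLayer_eq (h : FarFrom G v r (diffVerts G G')) (σ : Equiv.Perm (Fin n)) {k : ℕ}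
    (hk : k ≤ r) : bfsLayer G v σ k = bfsLayer G' v σ k := by
  induction k with
  | zero => rfl
  | succ k ih =>
    have ih' := ih (by omega)
    have hf := fun w => h.find?_eq (σ := σ) (by omega : k ≤ r) w
    rw [ih'] at hf
    simp only [bfsLayer, h.dist_iff (by omega : k + 1 ≤ r + 1), ih', hf]

lemma FarFrom.bfsPathAux_eq (h : FarFrom G v r (diffVerts G G')) (σ : Equiv.Perm (Fin n)) {k : ℕ}
    (hk : k ≤ r) (w : Fin n) : bfsPathAux G v σ k w = bfsPathAux G' v σ k w := by
  induction k generalizing w with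
  | zero => rfl
  | succ k ih =>
    have hf := fun w => h.find?_eq (σ := σ) (by omega : k ≤ r) w
    rw [h.bfsLayer_eq σ (by omega : k ≤ r)] at hf
    simp only [bfsPathAux, h.bfsLayer_eq σ hk, h.bfsLayer_eq σ (by omega : k ≤ r),
      ih (by omega), hf]

lemma length_of_bfsPathAux_eq_some {σ : Equiv.Perm (Fin n)} {k : ℕ} {w : Fin n} {l : List ℕ}
    (h : bfsPathAux G v σ k w = some l) : l.length = k := by
  induction k generalizing w l with
  | zero =>
    simp only [bfsPathAux] at h
    split_ifs at h
    simp at h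
    simp [← h]
  | succ k ih =>
    simp only [bfsPathAux] at h
    split at h
    · simp at h
    · simp only [Option.map_eq_some_iff] at h
      obtain ⟨l', h1, rfl⟩ := h
      simp [ih h1]

lemma bfsPath_eq_some_iff {σ : Equiv.Perm (Fin n)} {w : Fin n} {l : List ℕ} :
    bfsPath G v σ w = some l ↔
      (G.Reachable v w ∧ G.dist v w = l.length) ∧ bfsPathAux G v σ l.length w = some l := by
  unfold bfsPath
  constructor
  · intro h
    split_ifs at h with hr
    have := length_of_bfsPathAux_eq_some h
    rw [← this] at h
    exact ⟨⟨hr, this.symm⟩, h⟩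
  · rintro ⟨⟨h1, h2⟩, h3⟩
    rw [if_pos h1, h2, h3]

lemma FarFrom.bfsPath_eq_some_iff (h : FarFrom G v r (diffVerts G G')) (σ : Equiv.Perm (Fin n))
    {l : List ℕ} (hl : l.length ≤ r) (w : Fin n) :
    bfsPath G v σ w = some l ↔ bfsPath G' v σ w = some l := by
  rw [TreeEntropy.bfsPath_eq_some_iff, TreeEntropy.bfsPath_eq_some_iff,
    h.dist_iff (by omega), h.bfsPathAux_eq σ hl]

/-- The exploration up to distance `r` only sees the neighborhoods of the vertices at distance
at most `r` from the root. -/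
lemma FarFrom.resS_bfsRCG_eq {M : Type*} (h : FarFrom G v r (diffVerts G G'))
    (σ : Equiv.Perm (Fin n)) (f : Fin n → M) :
    resS r (bfsRCG G f v σ) = resS r (bfsRCG G' f v σ) := by
  refine RCG.ext (funext fun l => ?_) (funext fun p => ?_)
  · simp only [resS]
    split_ifs with hl
    · simp only [bfsRCG]
      have : (fun w => bfsPath G v σ w = some l) = fun w => bfsPath G' v σ w = some l :=
        funext fun w => propext (h.bfsPath_eq_some_iff σ hl w)
      convert congrArg (fun P : Fin n → Prop =>
        if h : ∃ w, P w then some (f h.choose) else none) this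
    · rfl
  · simp only [resS]
    split_ifs with hp
    · simp only [bfsRCG]
      refine if_congr (exists₂_congr fun w₁ w₂ => ?_) rfl rfl
      rw [← h.bfsPath_eq_some_iff σ hp.1, ← h.bfsPath_eq_some_iff σ hp.2]
      refine and_congr_right fun h1 => and_congr_right fun _ => ?_
      exact h.adj_iff hp.1
        (reachable_and_dist_eq_iff.1 (TreeEntropy.bfsPath_eq_some_iff.1 h1).1).1 w₂
    · rfl

lemma card_filter_exists_walk_le {d : ℕ} (hG : G ∈ regularGraphs d n) (D : Finset (Fin n))
    (k : ℕ) :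
    (Finset.univ.filter fun v => ∃ w ∈ D, ∃ p : G.Walk w v, p.length = k).card
      ≤ D.card * d ^ k := by
  induction k with
  | zero =>
    rw [pow_zero, mul_one]
    refine Finset.card_le_card fun v hv => ?_
    simp only [Finset.mem_filter, Finset.mem_univ, true_and] at hv
    obtain ⟨w, hw, p, hp⟩ := hv
    rwa [← SimpleGraph.Walk.eq_of_length_eq_zero hp]
  | succ k ih =>
    have hsub : (Finset.univ.filter fun v => ∃ w ∈ D, ∃ p : G.Walk w v, p.length = k + 1)
        ⊆ (Finset.univ.filter fun v => ∃ w ∈ D, ∃ p : G.Walk w v, p.length = k).biUnion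
          fun u => (G.neighborSet u).toFinset := by
      intro v hv
      simp only [Finset.mem_filter, Finset.mem_univ, true_and, exists_walk_length_succ] at hv
      obtain ⟨w, hw, u, hu, huv⟩ := hv
      simp only [Finset.mem_biUnion, Finset.mem_filter, Finset.mem_univ, true_and,
        Set.mem_toFinset]
      exact ⟨u, ⟨w, hw, hu⟩, huv⟩
    refine (Finset.card_le_card hsub).trans
      ((Finset.card_biUnion_le_card_mul _ _ d fun u _ => ?_).trans ?_)
    · rw [← Set.ncard_eq_toFinset_card', hG u]
    · rw [pow_succ, ← mul_assoc]
      exact Nat.mul_le_mul_right _ ih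

lemma card_filter_not_farFrom_le {d : ℕ} (hG : G ∈ regularGraphs d n) (D : Finset (Fin n))
    (r : ℕ) :
    (Finset.univ.filter fun v => ¬ FarFrom G v r D).card
      ≤ (∑ k ∈ Finset.range (r + 1), d ^ k) * D.card := by
  have hsub : (Finset.univ.filter fun v => ¬ FarFrom G v r D)
      ⊆ (Finset.range (r + 1)).biUnion fun k =>
        Finset.univ.filter fun v => ∃ w ∈ D, ∃ p : G.Walk w v, p.length = k := by
    intro v hv
    simp only [Finset.mem_filter, Finset.mem_univ, true_and, FarFrom, not_forall, not_not] at hv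
    obtain ⟨k, hk, w, hw, p, hp⟩ := hv
    simp only [Finset.mem_biUnion, Finset.mem_range, Finset.mem_filter, Finset.mem_univ, true_and]
    exact ⟨k, by omega, w, hw, p.reverse, by simpa using hp⟩
  refine (Finset.card_le_card hsub).trans (Finset.card_biUnion_le.trans ?_)
  rw [Finset.sum_mul]
  refine Finset.sum_le_sum fun k _ => ?_
  rw [mul_comm]
  exact card_filter_exists_walk_le hG D k

end Locality

lemma resS_resS {M : Type*} (k r : ℕ) (g : RCG M) : resS k (resS r g) = resS (min k r) g := by
  refine RCG.ext (funext fun l => ?_) (funext fun p => ?_)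
  · simp only [resS, le_min_iff, ite_and]
  · simp only [resS, le_min_iff]
    split_ifs <;> first | rfl | omega

lemma dist_le_of_resS_eq {M : Type*} {r : ℕ} {g g' : RCG M} (h : resS r g = resS r g') :
    dist g g' ≤ (2 : ℝ)⁻¹ ^ r := by
  change rcgDist g g' ≤ _
  unfold rcgDist
  rw [← (rcg_summable g g').sum_add_tsum_nat_add (r + 1), Finset.sum_eq_zero, zero_add]
  · have hs : Summable fun k : ℕ => (2 : ℝ)⁻¹ ^ (k + (r + 1)) :=
      (summable_nat_add_iff (r + 1)).2
        (summable_geometric_of_lt_one (by norm_num) (by norm_num : (2 : ℝ)⁻¹ < 1))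
    refine (Summable.tsum_le_tsum (fun k => ?_)
      ((summable_nat_add_iff (r + 1)).2 (rcg_summable g g')) hs).trans (le_of_eq ?_)
    · split_ifs
      · positivity
      · exact le_rfl
    · simp only [pow_add, tsum_mul_right]
      rw [tsum_geometric_inv_two]
      ring
  · intro k hk
    rw [Finset.mem_range] at hk
    rw [if_pos]
    have := congrArg (resS k) h
    rwa [resS_resS, resS_resS, min_eq_left (by omega)] at this

lemma dist_resS_le {M : Type*} (r : ℕ) (g : RCG M) : dist (resS r g) g ≤ (2 : ℝ)⁻¹ ^ r :=
  dist_le_of_resS_eq (by simp only [resS_resS, min_self])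

lemma lipschitzWith_resS {M : Type*} (r : ℕ) : LipschitzWith 1 (resS r : RCG M → RCG M) := by
  refine LipschitzWith.of_dist_le_mul fun g g' => ?_
  rw [NNReal.coe_one, one_mul]
  change rcgDist _ _ ≤ rcgDist _ _
  refine Summable.tsum_le_tsum (fun k => ?_) (rcg_summable _ _) (rcg_summable _ _)
  split_ifs with h1 h2 h2
  · exact le_rfl
  · positivity
  · exfalso
    apply h1
    rw [resS_resS, resS_resS, min_comm, ← resS_resS, ← resS_resS, h2]
  · exact le_rfl

lemma measurable_resS {M : Type*} (r : ℕ) : Measurable (resS r : RCG M → RCG M) :=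
  (lipschitzWith_resS r).continuous.measurable

lemma levyProkhorovEDist_map_map_le {Ω : Type*} [PseudoMetricSpace Ω] [MeasurableSpace Ω]
    [BorelSpace Ω] {F : Ω → Ω} (hF : LipschitzWith 1 F) (μ ν : Measure Ω) :
    levyProkhorovEDist (μ.map F) (ν.map F) ≤ levyProkhorovEDist μ ν := by
  have hm := hF.continuous.measurable
  have hsub : ∀ (ε : ℝ) (B : Set Ω),
      Metric.thickening ε (F ⁻¹' B) ⊆ F ⁻¹' Metric.thickening ε B := by
    intro ε B x hx
    obtain ⟨y, hy, hxy⟩ := Metric.mem_thickening_iff.1 hx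
    refine Metric.mem_thickening_iff.2 ⟨F y, hy, lt_of_le_of_lt ?_ hxy⟩
    simpa using hF.dist_le_mul x y
  refine levyProkhorovEDist_le_of_forall _ _ _ fun ε B hε _ hB => ?_
  rw [Measure.map_apply hm hB, Measure.map_apply hm hB,
    Measure.map_apply hm Metric.isOpen_thickening.measurableSet,
    Measure.map_apply hm Metric.isOpen_thickening.measurableSet]
  constructor
  · refine (left_measure_le_of_levyProkhorovEDist_lt hε (hm hB)).trans ?_
    gcongr
    exact hsub _ _
  · refine (right_measure_le_of_levyProkhorovEDist_lt hε (hm hB)).trans ?_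
    gcongr
    exact hsub _ _

lemma levyProkhorovEDist_map_self_le {Ω : Type*} [PseudoMetricSpace Ω] [MeasurableSpace Ω]
    [BorelSpace Ω] {F : Ω → Ω} (hm : Measurable F) {δ : ℝ} (hδ : 0 ≤ δ)
    (hF : ∀ x, dist (F x) x ≤ δ) (μ : Measure Ω) :
    levyProkhorovEDist (μ.map F) μ ≤ ENNReal.ofReal δ := by
  refine levyProkhorovEDist_le_of_forall _ _ _ fun ε B hε hε' hB => ?_
  have hlt : δ < ε.toReal := (ENNReal.ofReal_lt_iff_lt_toReal hδ hε'.ne).1 hε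
  rw [Measure.map_apply hm hB, Measure.map_apply hm Metric.isOpen_thickening.measurableSet]
  constructor
  · refine le_add_right (measure_mono fun x hx => ?_)
    refine Metric.mem_thickening_iff.2 ⟨F x, hx, ?_⟩
    rw [dist_comm]
    exact (hF x).trans_lt hlt
  · refine le_add_right (measure_mono fun x hx => ?_)
    exact Metric.mem_thickening_iff.2 ⟨x, hx, (hF x).trans_lt hlt⟩

section Distr

variable {M : Type*} {n : ℕ}

lemma distrAt_apply_le {G G' : SimpleGraph (Fin n)} {f : Fin n → M} {v : Fin n}
    {B B' : Set (RCG M)} (hB : MeasurableSet B) (hB' : MeasurableSet B')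
    (h : ∀ σ, bfsRCG G f v σ ∈ B → bfsRCG G' f v σ ∈ B') :
    distrAt G f v B ≤ distrAt G' f v B' := by
  simp only [distrAt, Measure.smul_apply, Measure.finsetSum_apply, smul_eq_mul,
    Measure.dirac_apply' _ hB, Measure.dirac_apply' _ hB']
  gcongr with σ
  simp only [Set.indicator_apply]
  split_ifs with h1 h2 h2
  · exact le_rfl
  · exact absurd (h σ h1) h2
  · simp
  · simp

instance (G : SimpleGraph (Fin n)) (f : Fin n → M) (v : Fin n) :
    IsProbabilityMeasure (distrAt G f v) := by
  constructor
  simp only [distrAt, Measure.smul_apply, Measure.finsetSum_apply, smul_eq_mul, measure_univ,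
    Finset.sum_const, Finset.card_univ, Fintype.card_perm, Fintype.card_fin, nsmul_eq_mul, mul_one]
  exact ENNReal.inv_mul_cancel (by exact_mod_cast n.factorial_ne_zero) (ENNReal.natCast_ne_top _)

instance (G : SimpleGraph (Fin n)) (f : Fin n → M) : IsFiniteMeasure (distrG G f) := by
  constructor
  simp only [distrG, Measure.smul_apply, Measure.finsetSum_apply, smul_eq_mul, measure_univ,
    Finset.sum_const, Finset.card_univ, Fintype.card_fin, nsmul_eq_mul, mul_one]
  exact ENNReal.inv_mul_le_one (n : ℝ≥0∞) |>.trans_lt ENNReal.one_lt_top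

lemma levyProkhorovEDist_distrG_le {G G' : SimpleGraph (Fin n)} {f : Fin n → M} {δ : ℝ}
    (hδ : 0 ≤ δ) (D : Finset (Fin n)) (hD : (D.card : ℝ) ≤ δ * n)
    (h : ∀ v ∉ D, ∀ σ, dist (bfsRCG G f v σ) (bfsRCG G' f v σ) ≤ δ) :
    levyProkhorovEDist (distrG G f) (distrG G' f) ≤ ENNReal.ofReal δ := by
  have hDn : ((n : ℝ≥0∞))⁻¹ * D.card ≤ ENNReal.ofReal δ := by
    rcases Nat.eq_zero_or_pos n with rfl | hn
    · have : D.card = 0 := by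
        have := Finset.card_le_univ D
        simpa using this
      simp [this]
    · rw [mul_comm, ← div_eq_mul_inv]
      refine ENNReal.div_le_of_le_mul ?_
      rw [← ENNReal.ofReal_natCast, ← ENNReal.ofReal_natCast n, ← ENNReal.ofReal_mul hδ]
      exact ENNReal.ofReal_le_ofReal hD
  have key : ∀ H H' : SimpleGraph (Fin n),
      (∀ v ∉ D, ∀ σ, dist (bfsRCG H f v σ) (bfsRCG H' f v σ) ≤ δ) →
      ∀ ε B, ENNReal.ofReal δ < ε → ε < ∞ → MeasurableSet B →
        distrG H f B ≤ distrG H' f (Metric.thickening ε.toReal B) + ε := by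
    intro H H' hH ε B hε hε' hB
    have hlt : δ < ε.toReal := (ENNReal.ofReal_lt_iff_lt_toReal hδ hε'.ne).1 hε
    have hth : MeasurableSet (Metric.thickening ε.toReal B) :=
      Metric.isOpen_thickening.measurableSet
    have h1 : ∀ v, distrAt H f v B ≤ distrAt H' f v (Metric.thickening ε.toReal B)
        + if v ∈ D then 1 else 0 := by
      intro v
      split_ifs with hv
      · exact le_add_left prob_le_one
      · refine le_add_right (distrAt_apply_le hB hth fun σ hσ => ?_)
        refine Metric.mem_thickening_iff.2 ⟨_, hσ, ?_⟩
        rw [dist_comm]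
        exact (hH v hv σ).trans_lt hlt
    calc distrG H f B = ((n : ℝ≥0∞))⁻¹ * ∑ v, distrAt H f v B := by
          simp [distrG, Measure.finsetSum_apply]
      _ ≤ ((n : ℝ≥0∞))⁻¹ * ∑ v, (distrAt H' f v (Metric.thickening ε.toReal B)
            + if v ∈ D then 1 else 0) := by
          gcongr with v
          exact h1 v
      _ = distrG H' f (Metric.thickening ε.toReal B) + ((n : ℝ≥0∞))⁻¹ * D.card := by
          rw [Finset.sum_add_distrib, mul_add]
          simp [distrG, Measure.finsetSum_apply]
      _ ≤ _ := by
          gcongr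
          exact hDn.trans hε.le
  exact levyProkhorovEDist_le_of_forall _ _ _ fun ε B hε hε' hB =>
    ⟨key G G' h ε B hε hε' hB,
      key G' G (fun v hv σ => by rw [dist_comm]; exact h v hv σ) ε B hε hε' hB⟩

end Distr

lemma levyProkhorovDist_map_map_le {Ω : Type*} [PseudoMetricSpace Ω] [MeasurableSpace Ω]
    [BorelSpace Ω] {F : Ω → Ω} (hF : LipschitzWith 1 F) (μ ν : Measure Ω) [IsFiniteMeasure μ]
    [IsFiniteMeasure ν] : levyProkhorovDist (μ.map F) (ν.map F) ≤ levyProkhorovDist μ ν :=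
  ENNReal.toReal_mono (levyProkhorovEDist_lt_top μ ν).ne (levyProkhorovEDist_map_map_le hF μ ν)

lemma levyProkhorovDist_map_resS_le {M : Type*} (r : ℕ) (μ : Measure (RCG M)) :
    levyProkhorovDist (μ.map (resS r)) μ ≤ (2 : ℝ)⁻¹ ^ r :=
  ENNReal.toReal_le_of_le_ofReal (by positivity)
    (levyProkhorovEDist_map_self_le (measurable_resS r) (by positivity)
      (dist_resS_le r) μ)

lemma levyProkhorovDist_le_map_resS {M : Type*} (r : ℕ) (μ ν : Measure (RCG M))
    [IsFiniteMeasure μ] [IsFiniteMeasure ν] :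
    levyProkhorovDist μ ν
      ≤ levyProkhorovDist (μ.map (resS r)) (ν.map (resS r)) + 2 * (2 : ℝ)⁻¹ ^ r := by
  have h1 := levyProkhorovDist_triangle μ (μ.map (resS r)) ν
  have h2 := levyProkhorovDist_triangle (μ.map (resS r)) (ν.map (resS r)) ν
  have h3 := levyProkhorovDist_map_resS_le r μ
  have h4 := levyProkhorovDist_map_resS_le r ν
  rw [levyProkhorovDist_comm] at h3
  linarith

/-- Regular graphs with few differing neighborhoods assign close statistics to a coloring. -/
lemma exists_levyProkhorovDist_distrG_le (d : ℕ) {ε : ℝ} (hε : 0 < ε) :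
    ∃ η > 0, ∀ (n : ℕ) (G G' : SimpleGraph (Fin n)), G ∈ regularGraphs d n →
      ((diffVerts G G').card : ℝ) ≤ η * n → ∀ {M : Type*} (f : Fin n → M),
        levyProkhorovDist (distrG G f) (distrG G' f) ≤ ε := by
  obtain ⟨r, hr⟩ := exists_pow_lt_of_lt_one hε (by norm_num : (2 : ℝ)⁻¹ < 1)
  set C : ℝ := ((∑ k ∈ Finset.range (r + 1), d ^ k : ℕ) : ℝ) + 1 with hC
  have hCpos : 0 < C := by positivity
  refine ⟨ε / C, by positivity, fun n G G' hG hdiff M f => ?_⟩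
  refine ENNReal.toReal_le_of_le_ofReal hε.le (levyProkhorovEDist_distrG_le hε.le
    (Finset.univ.filter fun v => ¬ FarFrom G v r (diffVerts G G')) ?_ fun v hv σ => ?_)
  · have h1 : ((Finset.univ.filter fun v => ¬ FarFrom G v r (diffVerts G G')).card : ℝ)
        ≤ ((∑ k ∈ Finset.range (r + 1), d ^ k : ℕ) : ℝ) * (diffVerts G G').card := by
      exact_mod_cast card_filter_not_farFrom_le hG _ r
    calc _ ≤ C * (diffVerts G G').card := h1.trans (by gcongr; rw [hC]; linarith)
      _ ≤ C * (ε / C * n) := by gcongr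
      _ = ε * n := by field_simp
  · simp only [Finset.mem_filter, Finset.mem_univ, true_and, not_not] at hv
    exact (dist_le_of_resS_eq (hv.resS_bfsRCG_eq σ f)).trans hr.le

lemma PrG_mono {d n : ℕ} {A B : Set (SimpleGraph (Fin n))}
    (h : ∀ G ∈ regularGraphs d n, G ∈ A → G ∈ B) : PrG d n A ≤ PrG d n B := by
  unfold PrG
  have := Set.ncard_le_ncard (s := regularGraphs d n ∩ A) (t := regularGraphs d n ∩ B)
    (fun G hG => ⟨hG.1, h G hG.1 hG.2⟩) (Set.toFinite _)
  gcongr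

lemma PrG_nonneg (d n : ℕ) (A : Set (SimpleGraph (Fin n))) : 0 ≤ PrG d n A := by
  unfold PrG
  positivity

lemma PrG_le_one (d n : ℕ) (A : Set (SimpleGraph (Fin n))) : PrG d n A ≤ 1 := by
  unfold PrG
  refine div_le_one_of_le₀ ?_ (by positivity)
  exact_mod_cast Set.ncard_le_ncard Set.inter_subset_left (Set.toFinite _)

instance (d : ℕ) : (goodFilter d).NeBot := by
  rw [goodFilter, ← frequently_mem_iff_neBot, frequently_atTop]
  exact fun a => ⟨2 * (a + d + 1), by omega, by omega, ⟨(a + d + 1) * d, by ring⟩⟩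

section Entropy

variable {M : Type*} [MeasurableSpace M] (d : ℕ) (μ : Measure (TdVertex d → M))

lemma typicalPr_le_one (ε : ℝ) (n : ℕ) : typicalPr d μ ε n ≤ 1 := PrG_le_one _ _ _

lemma typicalPr_nonneg (ε : ℝ) (n : ℕ) : 0 ≤ typicalPr d μ ε n := PrG_nonneg _ _ _

variable {d μ}

lemma typicalPr_mono {ε ε' : ℝ} (h : ε ≤ ε') (n : ℕ) : typicalPr d μ ε n ≤ typicalPr d μ ε' n :=
  PrG_mono fun _ _ ⟨f, hf⟩ => ⟨f, hf.trans h⟩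

lemma zero_le_HG_iff {n r : ℕ} {ε : ℝ} {G : SimpleGraph (Fin n)} :
    0 ≤ HG d μ r ε G ↔ (FSet d μ r ε G).Nonempty := by
  unfold HG
  split_ifs with h
  · simp [h]
  · refine iff_of_true ?_ (Set.nonempty_iff_ne_empty.2 h)
    exact_mod_cast div_nonneg (Real.log_natCast_nonneg _) (Nat.cast_nonneg n)

lemma zero_le_hquant_of_le {r n : ℕ} {ε α : ℝ}
    (h : α ≤ PrG d n {G | (FSet d μ r ε G).Nonempty}) : 0 ≤ hquant d μ r ε α n :=
  le_sSup ⟨Or.inr le_rfl, h.trans (PrG_mono fun _ _ hG => zero_le_HG_iff.2 hG)⟩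

lemma hquant_eq_bot_of_lt {r n : ℕ} {ε α : ℝ}
    (h : PrG d n {G | (FSet d μ r ε G).Nonempty} < α) : hquant d μ r ε α n = ⊥ := by
  refine le_bot_iff.1 (sSup_le ?_)
  rintro x ⟨rfl | hx, hα⟩
  · exact le_rfl
  · exact absurd (hα.trans (PrG_mono fun _ _ hG => zero_le_HG_iff.1 (hx.trans hG))) h.not_ge

lemma zero_le_limsup_hquant_iff {r : ℕ} {ε α : ℝ} :
    0 ≤ (goodFilter d).limsup (fun n => hquant d μ r ε α n) ↔
      ∃ᶠ n in goodFilter d, α ≤ PrG d n {G | (FSet d μ r ε G).Nonempty} := by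
  constructor
  · intro h
    by_contra hcon
    rw [not_frequently] at hcon
    have : (goodFilter d).limsup (fun n => hquant d μ r ε α n) ≤ ⊥ :=
      limsup_le_of_le (by isBoundedDefault)
        (hcon.mono fun n hn => (hquant_eq_bot_of_lt (not_le.1 hn)).le)
    exact absurd (h.trans this) (by simp)
  · intro h
    exact le_limsup_of_frequently_le (h.mono fun n hn => zero_le_hquant_of_le hn)
      (by isBoundedDefault)

lemma zero_le_liminf_hquant_iff {r : ℕ} {ε α : ℝ} :
    0 ≤ (goodFilter d).liminf (fun n => hquant d μ r ε α n) ↔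
      ∀ᶠ n in goodFilter d, α ≤ PrG d n {G | (FSet d μ r ε G).Nonempty} := by
  constructor
  · intro h
    have := eventually_lt_of_lt_liminf (lt_of_lt_of_le EReal.bot_lt_zero h)
      (by isBoundedDefault)
    filter_upwards [this] with n hn
    by_contra! hlt
    exact hn.ne' (hquant_eq_bot_of_lt hlt)
  · intro h
    exact le_liminf_of_le (by isBoundedDefault) (h.mono fun n hn => zero_le_hquant_of_le hn)

variable [IsFiniteMeasure μ]

instance : IsFiniteMeasure (lawTd d μ) := by
  unfold lawTd
  infer_instance

lemma typicalPr_le_PrG_nonempty (r : ℕ) (ε : ℝ) (n : ℕ) :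
    typicalPr d μ ε n ≤ PrG d n {G | (FSet d μ r ε G).Nonempty} :=
  PrG_mono fun _ _ ⟨f, hf⟩ =>
    ⟨f, (levyProkhorovDist_map_map_le (lipschitzWith_resS r) _ _).trans hf⟩

lemma PrG_nonempty_le_typicalPr (r : ℕ) (ε : ℝ) (n : ℕ) :
    PrG d n {G | (FSet d μ r ε G).Nonempty} ≤ typicalPr d μ (ε + 2 * (2 : ℝ)⁻¹ ^ r) n := by
  refine PrG_mono fun _ _ ⟨f, hf⟩ => ⟨f, (levyProkhorovDist_le_map_resS r _ _).trans ?_⟩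
  have : levyProkhorovDist _ _ ≤ ε := hf
  linarith

lemma exists_PrG_nonempty_le_typicalPr {ε : ℝ} (hε : 0 < ε) : ∃ r : ℕ, ∀ n,
    PrG d n {G | (FSet d μ r (ε / 2) G).Nonempty} ≤ typicalPr d μ ε n := by
  obtain ⟨r, hr⟩ := exists_pow_lt_of_lt_one (by positivity : 0 < ε / 4)
    (by norm_num : (2 : ℝ)⁻¹ < 1)
  exact ⟨r, fun n => (PrG_nonempty_le_typicalPr r (ε / 2) n).trans
    (typicalPr_mono (by linarith) n)⟩

lemma zero_le_hbar_iff : 0 ≤ hbar d μ ↔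
    ∀ ε > 0, ∃ᶠ n in goodFilter d, 1 / 2 ≤ typicalPr d μ ε n := by
  simp only [hbar, hbarR, hbarA, le_iInf_iff, zero_le_limsup_hquant_iff, Subtype.forall]
  constructor
  · intro h ε hε
    obtain ⟨r, hr⟩ := exists_PrG_nonempty_le_typicalPr (d := d) (μ := μ) hε
    exact (h r (ε / 2) (half_pos hε)).mono fun n hn => hn.trans (hr n)
  · intro h r ε hε
    exact (h ε hε).mono fun n hn => hn.trans (typicalPr_le_PrG_nonempty r ε n)

lemma zero_le_hlow_iff : 0 ≤ hlow d μ ↔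
    ∀ ε > 0, ∀ᶠ n in goodFilter d, 1 / 2 ≤ typicalPr d μ ε n := by
  simp only [hlow, hlowR, hlowA, le_iInf_iff, zero_le_liminf_hquant_iff, Subtype.forall]
  constructor
  · intro h ε hε
    obtain ⟨r, hr⟩ := exists_PrG_nonempty_le_typicalPr (d := d) (μ := μ) hε
    exact (h r (ε / 2) (half_pos hε)).mono fun n hn => hn.trans (hr n)
  · intro h r ε hε
    exact (h ε hε).mono fun n hn => hn.trans (typicalPr_le_PrG_nonempty r ε n)

/-- If a coloring with the desired statistics exists with probability at least one half, then a
coloring with slightly worse statistics exists with probability close to one. -/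
lemma eventually_typicalPr_ge (hd : 0 < d) {ε δ : ℝ} (hε : 0 < ε) (hδ : 0 < δ) :
    ∀ᶠ n in goodFilter d, 1 / 2 ≤ typicalPr d μ (ε / 2) n → 1 - δ ≤ typicalPr d μ ε n := by
  obtain ⟨η, hη, hclose⟩ := exists_levyProkhorovDist_distrG_le d (half_pos hε)
  filter_upwards [eventually_le_PrG_diffVerts hd hη hδ] with n hn hhalf
  refine (hn _ hhalf).trans (PrG_mono ?_)
  rintro G hG ⟨G', ⟨-, f, hf⟩, hdiff⟩
  refine ⟨f, (levyProkhorovDist_triangle _ (distrG G' f) _).trans ?_⟩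
  have := hclose n G G' hG hdiff f
  linarith

lemma weaklyTypical_iff (hd : 0 < d) : WeaklyTypical d μ ↔
    ∀ ε > 0, ∃ᶠ n in goodFilter d, 1 / 2 ≤ typicalPr d μ ε n := by
  have hbdd : ∀ ε, IsBoundedUnder (· ≤ ·) (goodFilter d) fun n => typicalPr d μ ε n :=
    fun ε => isBoundedUnder_of ⟨1, typicalPr_le_one d μ ε⟩
  have hcobdd : ∀ ε, IsCoboundedUnder (· ≤ ·) (goodFilter d) fun n => typicalPr d μ ε n :=
    fun ε => (isBoundedUnder_of ⟨0, typicalPr_nonneg d μ ε⟩ :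
      IsBoundedUnder (· ≥ ·) _ _).isCoboundedUnder_le
  constructor
  · intro h ε hε
    obtain ⟨ε', hlt, hε'⟩ := ((h.eventually (lt_mem_nhds (by norm_num : (1 / 2 : ℝ) < 1))).and
      (Ioo_mem_nhdsGT hε)).exists
    exact (frequently_lt_of_lt_limsup (hcobdd ε') hlt).mono fun n hn =>
      hn.le.trans (typicalPr_mono hε'.2.le n)
  · intro h
    refine tendsto_const_nhds.congr' ?_
    filter_upwards [self_mem_nhdsWithin] with ε hε
    refine le_antisymm (le_of_forall_pos_le_add fun δ hδ => ?_)
      (limsup_le_of_le (hcobdd ε) (Eventually.of_forall (typicalPr_le_one d μ ε)))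
    rw [← sub_le_iff_le_add]
    exact le_limsup_of_frequently_le (((h _ (half_pos hε)).and_eventually
      (eventually_typicalPr_ge hd hε hδ)).mono fun n hn => hn.2 hn.1) (hbdd ε)

lemma stronglyTypical_iff (hd : 0 < d) : StronglyTypical d μ ↔
    ∀ ε > 0, ∀ᶠ n in goodFilter d, 1 / 2 ≤ typicalPr d μ ε n := by
  constructor
  · rintro ⟨L, hL, h⟩ ε hε
    obtain ⟨ε', hlt, hε'⟩ := ((h.eventually (lt_mem_nhds (by norm_num : (1 / 2 : ℝ) < 1))).and
      (Ioo_mem_nhdsGT hε)).exists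
    exact ((hL ε' hε'.1).eventually (lt_mem_nhds hlt)).mono fun n hn =>
      hn.le.trans (typicalPr_mono hε'.2.le n)
  · intro h
    refine ⟨fun _ => 1, fun ε hε => ?_, tendsto_const_nhds⟩
    refine tendsto_order.2 ⟨fun a ha => ?_, fun a ha =>
      Eventually.of_forall fun n => (typicalPr_le_one d μ ε n).trans_lt ha⟩
    filter_upwards [h _ (half_pos hε),
      eventually_typicalPr_ge (μ := μ) hd hε (half_pos (sub_pos.2 ha))] with n h1 h2
    have := h2 h1
    linarith

end Entropy

/-- For `d ≥ 3`, a finite color set `M` and `μ ∈ I_d(M)`: the upper sofic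
entropy satisfies `h̄(μ) ≥ 0` iff `μ` is weakly typical, and the lower sofic entropy
satisfies `h̲(μ) ≥ 0` iff `μ` is strongly typical. -/
theorem typical_iff_entropy_nonneg
    (d : ℕ) (hd : 3 ≤ d) (M : Type) [Fintype M] [MeasurableSpace M]
    [DiscreteMeasurableSpace M]
    (μ : Measure (TdVertex d → M)) (hμ : μ ∈ InvMeas d M) :
    ((0 : EReal) ≤ hbar d μ ↔ WeaklyTypical d μ) ∧
    ((0 : EReal) ≤ hlow d μ ↔ StronglyTypical d μ) := by
  have := hμ.1
  exact ⟨zero_le_hbar_iff.trans (weaklyTypical_iff (by omega)).symm,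
    zero_le_hlow_iff.trans (stronglyTypical_iff (by omega)).symm⟩

end TreeEntropy
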